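/- arXiv:0806.1750 — 13 statements merged into one kernel-verified Lean document; each statement's English description precedes it below -/
import Mathlib

section
/- Let L be a first-order language with no relation symbols, let F be an L-structure generated by a single element x, and let p and q be unary L-terms; for a unary term t and element m of F write t(m) for the realization of t at m, so that p(x), q(x), p(q(x)), p(q(q(x))) etc. are elements of F. Assume that for all elements m1, m2 of F there exists an L-homomorphism from the substructure of F generated by {p(x), q(x)} into F carrying p(x) to m1 and q(x) to m2 (this expresses that p(x) and q(x) are free generators of that substructure relative to the variety generated by F). Then for all elements m1, m2, m3 of F there exists an L-homomorphism from the substructure of F generated by {p(x), p(q(x)), p(q(q(x)))} into F carrying p(x) to m1, p(q(x)) to m2, and p(q(q(x))) to m3 (so these three elements are free generators of that substructure relative to the variety generated by F). -/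
open FirstOrder FirstOrder.Language

theorem aux_hom {L : FirstOrder.Language} [L.IsAlgebraic] {F : Type*} [L.Structure F] {n : Type*}
    (v w : n → F) (S : Set F) (hS : S = Set.range v)
    (h : ∀ s t : L.Term n, s.realize v = t.realize v → s.realize w = t.realize w) :
    ∃ f : ↥(Substructure.closure L S) →[L] F, ∀ i (hi : v i ∈ Substructure.closure L S),
      f ⟨v i, hi⟩ = w i := by
  have key : ∀ y : Substructure.closure L S, ∃ t : L.Term n, t.realize v = (y : F) := by
    rintro ⟨y, hy⟩
    obtain ⟨t, ht⟩ := Substructure.mem_closure_iff_exists_term.1 hy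
    have hc : ∀ z : S, ∃ i, v i = z := fun z => hS.le z.2
    choose g hg using hc
    refine ⟨t.relabel g, ?_⟩
    rw [Term.realize_relabel]
    have : v ∘ g = (↑) := funext hg
    rw [this, ht]
  choose T hT using key
  refine ⟨⟨fun y => (T y).realize w, ?_, ?_⟩, ?_⟩
  · intro k f y
    have := h (T (Structure.funMap f y)) (Term.func f fun i => T (y i)) (by
      rw [hT, Term.realize_func]
      simp only [hT]
      rfl)
    rw [this, Term.realize_func]
    rfl
  · intro k r
    exact isEmptyElim r
  · intro i hi
    exact h (T ⟨v i, hi⟩) (Term.var i) (by rw [hT]; rfl)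

/-- If the free algebra `F` on one generator `x` in the variety it generates has a subalgebra
free on the two generators `p x` and `q x` (expressed by the existence of homomorphisms into
`F` sending these generators to arbitrary elements), then the subalgebra generated by
`p x`, `p (q x)`, `p (q (q x))` is free on those three generators in the same sense. -/
theorem free_on_three_of_free_on_two
    {L : FirstOrder.Language} [L.IsAlgebraic] {F : Type*} [L.Structure F] (x : F)
    (hgen : Substructure.closure L ({x} : Set F) = ⊤)
    (p q : L.Term Unit)
    (hfree2 : ∀ m₁ m₂ : F,
      ∃ f : ↥(Substructure.closure L
          ({p.realize fun _ => x, q.realize fun _ => x} : Set F)) →[L] F,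
        f ⟨p.realize fun _ => x, Substructure.subset_closure (by simp)⟩ = m₁ ∧
        f ⟨q.realize fun _ => x, Substructure.subset_closure (by simp)⟩ = m₂) :
    ∀ m₁ m₂ m₃ : F,
      ∃ f : ↥(Substructure.closure L
          ({p.realize fun _ => x,
            p.realize fun _ => q.realize fun _ => x,
            p.realize fun _ => q.realize fun _ => q.realize fun _ => x} : Set F)) →[L] F,
        f ⟨p.realize fun _ => x,
            Substructure.subset_closure (by simp)⟩ = m₁ ∧
        f ⟨p.realize fun _ => q.realize fun _ => x,
            Substructure.subset_closure (by simp)⟩ = m₂ ∧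
        f ⟨p.realize fun _ => q.realize fun _ => q.realize fun _ => x,
            Substructure.subset_closure (by simp)⟩ = m₃ := by
  classical
  intro m₁ m₂ m₃
  have rep : ∀ m : F, ∃ r : L.Term Unit, (r.realize fun _ => x) = m := by
    intro m
    have hm : m ∈ Substructure.closure L ({x} : Set F) := by rw [hgen]; trivial
    obtain ⟨t, ht⟩ := Substructure.mem_closure_iff_exists_term.1 hm
    refine ⟨t.relabel fun _ => (), ?_⟩
    rw [Term.realize_relabel, ← ht]
    congr 1
    funext z
    exact z.2.symm
  have H : ∀ s t : L.Term (Fin 2),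
      s.realize ![p.realize fun _ => x, q.realize fun _ => x] =
        t.realize ![p.realize fun _ => x, q.realize fun _ => x] →
      ∀ a b : F, s.realize ![a, b] = t.realize ![a, b] := by
    intro s t hst a b
    obtain ⟨f, hf1, hf2⟩ := hfree2 a b
    let A := Substructure.closure L
          ({p.realize fun _ => x, q.realize fun _ => x} : Set F)
    let u : Fin 2 → A := ![⟨p.realize fun _ => x, Substructure.subset_closure (by simp)⟩,
      ⟨q.realize fun _ => x, Substructure.subset_closure (by simp)⟩]
    have hu : (A.subtype ∘ u) = ![p.realize fun _ => x, q.realize fun _ => x] := by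
      funext i; fin_cases i <;> rfl
    have hfu : f ∘ u = ![a, b] := by
      funext i; fin_cases i
      · exact hf1
      · exact hf2
    have e : s.realize u = t.realize u := by
      apply A.subtype.injective
      rw [← HomClass.realize_term, ← HomClass.realize_term, hu, hst]
    rw [← hfu, HomClass.realize_term, HomClass.realize_term, e]
  have H3 : ∀ (s t : L.Term (Fin 3)) (σ : Fin 3 → L.Term (Fin 2)),
      (s.realize fun i => (σ i).realize ![p.realize fun _ => x, q.realize fun _ => x]) =
        (t.realize fun i => (σ i).realize ![p.realize fun _ => x, q.realize fun _ => x]) →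
      ∀ a b : F, (s.realize fun i => (σ i).realize ![a, b]) =
        t.realize fun i => (σ i).realize ![a, b] := by
    intro s t σ h a b
    have := H (s.subst σ) (t.subst σ) (by simpa only [Term.realize_subst] using h) a b
    simpa only [Term.realize_subst] using this
  obtain ⟨r₁, hr₁⟩ := rep m₁
  obtain ⟨r₂, hr₂⟩ := rep m₂
  let P : F → F := fun z => p.realize fun _ => z
  let Q : F → F := fun z => q.realize fun _ => z
  let R₁ : F → F := fun z => r₁.realize fun _ => z
  let R₂ : F → F := fun z => r₂.realize fun _ => z
  have vec : ∀ (σ : Fin 3 → L.Term (Fin 2)) (a b : F),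
      (fun i => (σ i).realize ![a, b]) =
        ![(σ 0).realize ![a, b], (σ 1).realize ![a, b], (σ 2).realize ![a, b] ] := by
    intro σ a b; funext i; fin_cases i <;> rfl
  have main : ∀ s t : L.Term (Fin 3),
      s.realize ![P x, P (Q x), P (Q (Q x))] = t.realize ![P x, P (Q x), P (Q (Q x))] →
      s.realize ![m₁, m₂, m₃] = t.realize ![m₁, m₂, m₃] := by
    intro s t h0
    let X : L.Term (Fin 2) := Term.var 0
    let Y : L.Term (Fin 2) := Term.var 1
    have step : ∀ σ₀ σ₁ σ₂ : L.Term (Fin 2),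
        s.realize ![σ₀.realize ![P x, Q x], σ₁.realize ![P x, Q x], σ₂.realize ![P x, Q x] ] =
        t.realize ![σ₀.realize ![P x, Q x], σ₁.realize ![P x, Q x], σ₂.realize ![P x, Q x] ] →
        ∀ a b : F, s.realize ![σ₀.realize ![a, b], σ₁.realize ![a, b], σ₂.realize ![a, b] ] =
        t.realize ![σ₀.realize ![a, b], σ₁.realize ![a, b], σ₂.realize ![a, b] ] := by
      intro σ₀ σ₁ σ₂ h a b
      have := H3 s t ![σ₀, σ₁, σ₂] (by rw [vec]; exact h) a b
      rw [vec] at this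
      exact this
    have s1 : ∀ a b : F, s.realize ![a, P b, P (Q b)] = t.realize ![a, P b, P (Q b)] := by
      intro a b
      have := step X (p.subst fun _ => Y) (p.subst fun _ => q.subst fun _ => Y)
        (by simpa [X, Y, P, Q] using h0) a b
      simpa [X, Y, P, Q] using this
    have s2 : ∀ a b : F, s.realize ![R₁ (Q b), a, P b] = t.realize ![R₁ (Q b), a, P b] := by
      intro a b
      have h1 := s1 (R₁ (Q (Q x))) x
      have := step (r₁.subst fun _ => q.subst fun _ => Y) X (p.subst fun _ => Y)
        (by simpa [X, Y, P, Q, R₁] using h1) a b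
      simpa [X, Y, P, Q, R₁] using this
    have s3 : ∀ a b : F, s.realize ![R₁ b, R₂ b, a] = t.realize ![R₁ b, R₂ b, a] := by
      intro a b
      have h1 := s2 (R₂ (Q x)) x
      have := step (r₁.subst fun _ => Y) (r₂.subst fun _ => Y) X
        (by simpa [X, Y, P, Q, R₁, R₂] using h1) a b
      simpa [X, Y, P, Q, R₁, R₂] using this
    have := s3 m₃ x
    rw [← hr₁, ← hr₂]
    exact this
  obtain ⟨f, hf⟩ := aux_hom (L := L) ![P x, P (Q x), P (Q (Q x))] ![m₁, m₂, m₃]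
    ({P x, P (Q x), P (Q (Q x))} : Set F) (by
      ext z; simp; tauto) main
  exact ⟨f, hf 0 _, hf 1 _, hf 2 _⟩
end

section
/- Let (A_j)_{j∈ι} be a family of L-structures and let P be the prevariety generated by it. Let B be a structure in P, let (B_i)_{i∈I} be a family of structures in P, and let f_i : B_i → B be L-homomorphisms. Then the following are equivalent: (1) B together with the maps f_i is a coproduct of the (B_i) in P, i.e., for every structure C in P and every family of homomorphisms a_i : B_i → C there is a unique homomorphism a : B → C with a ∘ f_i = a_i for all i; (2) B is generated as a structure by the union of the images f_i(B_i), and for every index j ∈ ι and every family of homomorphisms g_i : B_i → A_j there is a homomorphism g : B → A_j with g ∘ f_i = g_i for all i. -/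
open FirstOrder FirstOrder.Language

universe u v w

namespace Paper

/-- The product `L`-structure on a Pi type. -/
instance piStructure {L : FirstOrder.Language.{v, w}} {ι : Type*} {M : ι → Type*}
    [∀ i, L.Structure (M i)] : L.Structure (∀ i, M i) where
  funMap f x i := Structure.funMap f fun j => x j i
  RelMap r x := ∀ i, Structure.RelMap r fun j => x j i

/-- A bundled `L`-structure with carrier in universe `u`. -/
structure SStr (L : FirstOrder.Language.{v, w}) where
  carrier : Type u
  [str : L.Structure carrier]

attribute [instance] SStr.str

variable {L : FirstOrder.Language.{v, w}}

/-- A structure is trivial when it has exactly one element. -/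
def SStr.IsTrivial (M : SStr.{u} L) : Prop := ∃ x : M.carrier, ∀ y : M.carrier, y = x

/-- A prevariety: a class of structures closed under isomorphism, substructures and
arbitrary direct products. -/
def IsPrevariety (P : Set (SStr.{u} L)) : Prop :=
  (∀ M N : SStr.{u} L, M ∈ P → Nonempty (N.carrier ≃[L] M.carrier) → N ∈ P) ∧
  (∀ M : SStr.{u} L, M ∈ P → ∀ S : L.Substructure M.carrier, SStr.mk ↥S ∈ P) ∧
  (∀ (ι : Type u) (M : ι → SStr.{u} L), (∀ i, M i ∈ P) →
    SStr.mk (∀ i, (M i).carrier) ∈ P)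

/-- Membership in the prevariety generated by a family `X`: embeddability into a direct
product of members of the family (with repetitions allowed). -/
def MemGenPrevariety {κ : Type*} (X : κ → SStr.{u} L) (N : SStr.{u} L) : Prop :=
  ∃ (ι : Type u) (f : ι → κ), Nonempty (N.carrier ↪[L] ∀ i, (X (f i)).carrier)

/-- A family of substructures of `A` is `P`-independent if the substructure they generate,
with the inclusion maps, is a coproduct of the family in `P`. -/
def PIndependent (P : Set (SStr.{u} L)) (A : SStr.{u} L) {I : Type*}
    (B : I → L.Substructure A.carrier) : Prop :=
  ∀ C : SStr.{u} L, C ∈ P → ∀ g : ∀ i, B i →[L] C.carrier,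
    ∃! h : ↥(⨆ i, B i) →[L] C.carrier,
      ∀ i, h.comp (Substructure.inclusion (le_iSup B i)).toHom = g i

/-- A family of structures is `P`-compatible if some structure in `P` admits embeddings of
all of them. -/
def PCompatible (P : Set (SStr.{u} L)) {I : Type*} (M : I → SStr.{u} L) : Prop :=
  ∃ D ∈ P, ∀ i, Nonempty ((M i).carrier ↪[L] D.carrier)

/-- Subdirect irreducibility. -/
def SubdirectlyIrreducible (M : SStr.{u} L) : Prop :=
  ∀ (J : Type u) (N : J → SStr.{u} L) (h : M.carrier ↪[L] ∀ j, (N j).carrier),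
    (∀ j, Function.Surjective fun m => h m j) → ∃ j, Function.Bijective fun m => h m j

/-- Closure under ultraproducts. -/
def ClosedUnderUltraproducts (P : Set (SStr.{u} L)) : Prop :=
  ∀ (α : Type u) (uf : Ultrafilter α) (M : α → SStr.{u} L), (∀ a, M a ∈ P) →
    SStr.mk ((uf : Filter α).Product fun a => (M a).carrier) ∈ P

/-- A quasivariety: a prevariety closed under ultraproducts. -/
def IsQuasivariety (P : Set (SStr.{u} L)) : Prop :=
  IsPrevariety P ∧ ClosedUnderUltraproducts P

/-- A class of structures is absolutely directed under embeddability. -/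
def AbsolutelyDirected (X : Set (SStr.{u} L)) : Prop :=
  ∀ (K : Type u) (M : K → SStr.{u} L), (∀ k, M k ∈ X) →
    ∃ D ∈ X, ∀ k, Nonempty ((M k).carrier ↪[L] D.carrier)

/-- `X` generates `P` as a prevariety. -/
def GeneratesPrevariety (X P : Set (SStr.{u} L)) : Prop :=
  X ⊆ P ∧ ∀ N ∈ P, ∃ (ι : Type u) (M : ι → SStr.{u} L),
    (∀ i, M i ∈ X) ∧ Nonempty (N.carrier ↪[L] ∀ i, (M i).carrier)

/-- A family of homomorphisms `f i : B i → A` realizes the coproduct of the `B i` in `P`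
inside `A`. -/
def RealizesCoproduct (P : Set (SStr.{u} L)) (A : SStr.{u} L) {I : Type*}
    (Bf : I → SStr.{u} L) (f : ∀ i, (Bf i).carrier →[L] A.carrier) : Prop :=
  ∀ C : SStr.{u} L, C ∈ P → ∀ g : ∀ i, (Bf i).carrier →[L] C.carrier,
    ∃! h : ↥(⨆ i, (f i).range) →[L] C.carrier,
      ∀ (i : I) (b : (Bf i).carrier),
        h ⟨f i b, SetLike.le_def.mp (le_iSup (fun i => (f i).range) i) (Hom.mem_range_self (f i) b)⟩ = g i b

/-- The amalgamation property for a class of structures. -/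
def HasAmalgamation (P : Set (SStr.{u} L)) : Prop :=
  ∀ A B C : SStr.{u} L, A ∈ P → B ∈ P → C ∈ P →
    ∀ (f : A.carrier ↪[L] B.carrier) (g : A.carrier ↪[L] C.carrier),
      ∃ D ∈ P, ∃ (f' : B.carrier ↪[L] D.carrier) (g' : C.carrier ↪[L] D.carrier),
        ∀ a, f' (f a) = g' (g a)


/-- A pair of homomorphisms `f₁ : B₁ → A`, `f₂ : B₂ → A` realizes the coproduct of the pair
`(B₁, B₂)` in `P` inside `A`. -/
def RealizesCoproductPair (P : Set (SStr.{u} L)) (A : SStr.{u} L) (B₁ B₂ : SStr.{u} L)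
    (f₁ : B₁.carrier →[L] A.carrier) (f₂ : B₂.carrier →[L] A.carrier) : Prop :=
  ∀ C : SStr.{u} L, C ∈ P →
    ∀ (g₁ : B₁.carrier →[L] C.carrier) (g₂ : B₂.carrier →[L] C.carrier),
      ∃! h : ↥(f₁.range ⊔ f₂.range) →[L] C.carrier,
        (∀ b, h ⟨f₁ b, SetLike.le_def.mp le_sup_left (Hom.mem_range_self f₁ b)⟩ = g₁ b) ∧
        (∀ b, h ⟨f₂ b, SetLike.le_def.mp le_sup_right (Hom.mem_range_self f₂ b)⟩ = g₂ b)

/-- A pair of substructures of `A` is `P`-independent if the substructure they generate,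
with the inclusion maps, is a coproduct of the pair in `P`. -/
def PIndependentPair (P : Set (SStr.{u} L)) (A : SStr.{u} L)
    (S₁ S₂ : L.Substructure A.carrier) : Prop :=
  ∀ C : SStr.{u} L, C ∈ P → ∀ (g₁ : S₁ →[L] C.carrier) (g₂ : S₂ →[L] C.carrier),
    ∃! h : ↥(S₁ ⊔ S₂) →[L] C.carrier,
      h.comp (Substructure.inclusion (le_sup_left : S₁ ≤ S₁ ⊔ S₂)).toHom = g₁ ∧
      h.comp (Substructure.inclusion (le_sup_right : S₂ ≤ S₁ ⊔ S₂)).toHom = g₂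


/-- Lemma: characterization of coproducts in the prevariety generated by a family. -/
theorem coproduct_iff_generated
    {L : FirstOrder.Language.{v, w}} {ι : Type*} (A : ι → SStr.{u} L)
    (B : SStr.{u} L) (hB : MemGenPrevariety A B)
    {I : Type*} (Bf : I → SStr.{u} L) (hBf : ∀ i, MemGenPrevariety A (Bf i))
    (f : ∀ i, (Bf i).carrier →[L] B.carrier) :
    (∀ C : SStr.{u} L, MemGenPrevariety A C →
        ∀ g : ∀ i, (Bf i).carrier →[L] C.carrier,
          ∃! h : B.carrier →[L] C.carrier, ∀ i, h.comp (f i) = g i)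
    ↔ (Substructure.closure L (⋃ i, Set.range ⇑(f i)) = ⊤ ∧
        ∀ (j : ι) (g : ∀ i, (Bf i).carrier →[L] (A j).carrier),
          ∃ h : B.carrier →[L] (A j).carrier, ∀ i, h.comp (f i) = g i) := by
  constructor
  · intro H
    constructor
    · let S := Substructure.closure L (⋃ i, Set.range ⇑(f i))
      have hmem : ∀ i b, f i b ∈ S := fun i b =>
        Substructure.subset_closure (Set.mem_iUnion.2 ⟨i, b, rfl⟩)
      obtain ⟨κ, k, ⟨e⟩⟩ := hB
      obtain ⟨h, hh, -⟩ := H (SStr.mk ↥S) ⟨κ, k, ⟨e.comp S.subtype⟩⟩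
        (fun i => (f i).codRestrict S (hmem i))
      obtain ⟨h0, -, hu⟩ := H B ⟨κ, k, ⟨e⟩⟩ f
      have h1 : S.subtype.toHom.comp h = h0 := by
        apply hu
        intro i
        ext b
        have := congrArg (fun t => ((t b : S) : B.carrier)) (hh i)
        exact this
      have h2 : Hom.id L B.carrier = h0 := by
        apply hu
        intro i
        ext b
        rfl
      rw [eq_top_iff]
      intro b _
      have h3 := congrArg (fun t => t b) (h1.trans h2.symm)
      have h4 : ((h b : S) : B.carrier) = b := h3
      rw [← h4]
      exact (h b).2
    · intro j g
      have hA : MemGenPrevariety A (A j) := by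
        refine ⟨PUnit, fun _ => j, ⟨⟨⟨fun a _ => a, ?_⟩, ?_, ?_⟩⟩⟩
        · intro a b hab
          exact congrFun hab PUnit.unit
        · intros
          rfl
        · intro n r x
          exact ⟨fun hx => hx PUnit.unit, fun hx _ => hx⟩
      exact (H (A j) hA g).exists
  · rintro ⟨hgen, hext⟩ C ⟨κ, k, ⟨e⟩⟩ g
    let p : ∀ t, (∀ t, (A (k t)).carrier) →[L] (A (k t)).carrier := fun t =>
      { toFun := fun x => x t
        map_fun' := fun _ _ => rfl
        map_rel' := fun _ _ hx => hx t }
    choose q hq using fun t => hext (k t) (fun i => (p t).comp (e.toHom.comp (g i)))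
    let h : B.carrier →[L] (∀ t, (A (k t)).carrier) :=
      { toFun := fun b t => q t b
        map_fun' := fun φ x => funext fun t => (q t).map_fun φ x
        map_rel' := fun r x hx t => (q t).map_rel r x hx }
    have hfe : ∀ i b, h (f i b) = e (g i b) := fun i b =>
      funext fun t => congrArg (fun u => u b) (hq t i)
    have hr : ∀ b, h b ∈ e.toHom.range := by
      have : Substructure.closure L (⋃ i, Set.range ⇑(f i)) ≤ e.toHom.range.comap h := by
        rw [Substructure.closure_le]
        intro b hb
        obtain ⟨i, c, rfl⟩ := Set.mem_iUnion.1 hb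
        exact ⟨g i c, (hfe i c).symm⟩
      intro b
      exact this (hgen ▸ Substructure.mem_top b)
    choose a ha using hr
    have ha' : ∀ b, e (a b) = h b := ha
    refine ⟨⟨a, ?_, ?_⟩, ?_, ?_⟩
    · intro n φ x
      apply e.injective
      rw [ha', h.map_fun, e.map_fun]
      congr 1
      funext m
      exact (ha' (x m)).symm
    · intro n r x hx
      rw [← e.map_rel]
      have : e ∘ a ∘ x = h ∘ x := funext fun m => ha' (x m)
      rw [this]
      exact h.map_rel r x hx
    · intro i
      ext b
      apply e.injective
      exact (ha' (f i b)).trans (hfe i b)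
    · intro a' ha2
      apply Hom.eq_of_eqOn_dense hgen
      intro b hb
      obtain ⟨i, c, rfl⟩ := Set.mem_iUnion.1 hb
      apply e.injective
      refine Eq.trans ?_ ((ha' (f i c)).trans (hfe i c)).symm
      exact congrArg (fun u => e (u c)) (ha2 i)
end Paper
end

section
/- Let A_0 be an L-structure, let n be a natural number, let A_0 ⊇ A_1 ⊇ … ⊇ A_n be substructures (with A_0 regarded as a substructure of itself), and let B_1, …, B_n be substructures of A_0 with B_i ⊆ A_{i-1} for each i ∈ {1,…,n}. Let P be the prevariety generated by A_n, and assume A_0 belongs to P (i.e., A_0 embeds into a direct power of A_n). Assume that for each i ∈ {1,…,n} the two-member family {A_i, B_i} of substructures of A_0 is P-independent. Then the family (B_1, …, B_n) of substructures of A_0 is P-independent. -/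
open FirstOrder FirstOrder.Language

universe u v w

namespace Paper

variable {L : FirstOrder.Language.{v, w}}

theorem aux_mem {M N : Type*} [L.Structure M] [L.Structure N] {S : L.Substructure M}
    (f : S →[L] N) (T : L.Substructure N) (s : Set M) (hS : S ≤ Substructure.closure L s)
    (h : ∀ x ∈ s, ∃ hx : x ∈ S, f ⟨x, hx⟩ ∈ T) (x : S) : f x ∈ T := by
  have key : Substructure.closure L s ≤ (T.comap f).map S.subtype.toHom := by
    rw [Substructure.closure_le]
    intro y hy
    obtain ⟨hyS, hyT⟩ := h y hy
    exact ⟨⟨y, hyS⟩, hyT, rfl⟩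
  obtain ⟨y, hy, hyx⟩ := key (hS x.2)
  have : y = x := Subtype.ext hyx
  exact this ▸ hy

theorem aux_chain {n : ℕ} {M : Type*} [L.Structure M]
    (A : Fin (n + 1) → L.Substructure M)
    (hchain : ∀ i : Fin n, A i.succ ≤ A i.castSucc) : Antitone A :=
  Fin.antitone_iff_succ_le.2 hchain

/-- generating set for the `j`-th stage -/
def gens {n : ℕ} {M : Type*} [L.Structure M] (T : L.Substructure M)
    (B : Fin n → L.Substructure M) (j : ℕ) : Set M :=
  {x | x ∈ T ∨ ∃ i : Fin n, j ≤ i.val ∧ x ∈ B i}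

theorem aux_stage (A₀ : SStr.{u} L) (n : ℕ)
    (A : Fin (n + 1) → L.Substructure A₀.carrier)
    (hchain : ∀ i : Fin n, A i.succ ≤ A i.castSucc)
    (B : Fin n → L.Substructure A₀.carrier)
    (hBA : ∀ i : Fin n, B i ≤ A i.castSucc)
    (P : Set (SStr.{u} L)) (hA₀P : A₀ ∈ P)
    (hind : ∀ i : Fin n, PIndependentPair P A₀ (A i.succ) (B i))
    (g : ∀ i, B i →[L] A (Fin.last n)) (k : ℕ) : ∀ j : ℕ, j + k = n →
    ∃ φ : Substructure.closure L (gens (A (Fin.last n)) B j) →[L] A (Fin.last n),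
      (∀ x (hx : x ∈ A (Fin.last n)) hx', φ ⟨x, hx'⟩ = ⟨x, hx⟩) ∧
      ∀ i : Fin n, j ≤ i.val → ∀ x (hx : x ∈ B i) hx', φ ⟨x, hx'⟩ = g i ⟨x, hx⟩ := by
  have anti := aux_chain A hchain
  induction k with
  | zero =>
    intro j hj
    have hle : Substructure.closure L (gens (A (Fin.last n)) B j) ≤ A (Fin.last n) := by
      rw [Substructure.closure_le]
      rintro x (hx | ⟨i, hi, -⟩)
      · exact hx
      · have := i.2; omega
    refine ⟨(Substructure.inclusion hle).toHom, fun x hx hx' => rfl, fun i hi => ?_⟩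
    have := i.2; omega
  | succ k ih =>
    intro j hj
    obtain ⟨φ, hφA, hφB⟩ := ih (j + 1) (by omega)
    let i₀ : Fin n := ⟨j, by omega⟩
    obtain ⟨f, ⟨hfA, hfB⟩, -⟩ := hind i₀ A₀ hA₀P (A i₀.succ).subtype.toHom
      ((A (Fin.last n)).subtype.toHom.comp (g i₀))
    have hfA' : ∀ x (hx : x ∈ A i₀.succ) hx', f ⟨x, hx'⟩ = x := fun x hx hx' =>
      DFunLike.congr_fun hfA ⟨x, hx⟩
    have hfB' : ∀ x (hx : x ∈ B i₀) hx', f ⟨x, hx'⟩ = (g i₀ ⟨x, hx⟩ : A₀.carrier) :=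
      fun x hx hx' => DFunLike.congr_fun hfB ⟨x, hx⟩
    have hlast : A (Fin.last n) ≤ A i₀.succ := anti (Fin.le_last _)
    have hBlt : ∀ i : Fin n, j + 1 ≤ i.val → B i ≤ A i₀.succ := fun i hi =>
      (hBA i).trans (anti (by rw [Fin.le_def]; simpa [i₀] using hi))
    have hle : Substructure.closure L (gens (A (Fin.last n)) B j) ≤ A i₀.succ ⊔ B i₀ := by
      rw [Substructure.closure_le]
      rintro x (hx | ⟨i, hi, hx⟩)
      · exact (le_sup_left : A i₀.succ ≤ _) (hlast hx)
      · rcases Nat.eq_or_lt_of_le hi with h | h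
        · have : i = i₀ := Fin.ext h.symm
          subst this
          exact (le_sup_right : _ ≤ A i₀.succ ⊔ B i₀) hx
        · exact (le_sup_left : A i₀.succ ≤ _) (hBlt i h hx)
    let f' := f.comp (Substructure.inclusion hle).toHom
    have hf'A : ∀ x (hx : x ∈ A i₀.succ) hx', f' ⟨x, hx'⟩ = x := fun x hx hx' => hfA' x hx _
    have hf'B : ∀ x (hx : x ∈ B i₀) hx', f' ⟨x, hx'⟩ = (g i₀ ⟨x, hx⟩ : A₀.carrier) :=
      fun x hx hx' => hfB' x hx _
    have hmem : ∀ x, f' x ∈ Substructure.closure L (gens (A (Fin.last n)) B (j + 1)) := by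
      refine aux_mem f' _ _ le_rfl fun x hx => ⟨Substructure.subset_closure hx, ?_⟩
      rcases hx with hx | ⟨i, hi, hx⟩
      · rw [hf'A x (hlast hx)]
        exact Substructure.subset_closure (Or.inl hx)
      · rcases Nat.eq_or_lt_of_le hi with h | h
        · have : i = i₀ := Fin.ext h.symm
          subst this
          rw [hf'B x hx]
          exact Substructure.subset_closure (Or.inl (g _ _).2)
        · rw [hf'A x (hBlt i h hx)]
          exact Substructure.subset_closure (Or.inr ⟨i, h, hx⟩)
    refine ⟨φ.comp (f'.codRestrict _ hmem), fun x hx hx' => ?_, fun i hi x hx hx' => ?_⟩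
    · have e : f'.codRestrict _ hmem ⟨x, hx'⟩ = ⟨x, Substructure.subset_closure (Or.inl hx)⟩ :=
        Subtype.ext (hf'A x (hlast hx) _)
      rw [Hom.comp_apply, e]
      exact hφA x hx _
    · rcases Nat.eq_or_lt_of_le hi with h | h
      · have : i = i₀ := Fin.ext h.symm
        subst this
        have e : f'.codRestrict _ hmem ⟨x, hx'⟩ =
            ⟨g _ ⟨x, hx⟩, Substructure.subset_closure (Or.inl (g _ _).2)⟩ :=
          Subtype.ext (hf'B x hx _)
        rw [Hom.comp_apply, e]
        exact hφA _ (g _ _).2 _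
      · have e : f'.codRestrict _ hmem ⟨x, hx'⟩ =
            ⟨x, Substructure.subset_closure (Or.inr ⟨i, h, hx⟩)⟩ :=
          Subtype.ext (hf'A x (hBlt i h hx) _)
        rw [Hom.comp_apply, e]
        exact hφB i h x hx _

/-- tuple of homomorphisms into a power -/
def powHom {ι M N : Type*} [L.Structure M] [L.Structure N] (h : ι → (M →[L] N)) :
    M →[L] (ι → N) where
  toFun x k := h k x
  map_fun' f x := funext fun k => (h k).map_fun f x
  map_rel' r x hx := fun k => (h k).map_rel r x hx

/-- coordinate projection -/
def projHom {ι N : Type*} [L.Structure N] (k : ι) : (ι → N) →[L] N where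
  toFun x := x k
  map_fun' f x := rfl
  map_rel' r x hx := hx k

/-- Theorem: iterated coproducts of subalgebras in the prevariety generated by `A n`. -/
theorem iterated_coproduct_independent
    {L : FirstOrder.Language.{v, w}} (A₀ : SStr.{u} L) (n : ℕ)
    (A : Fin (n + 1) → L.Substructure A₀.carrier)
    (hA0 : A 0 = ⊤)
    (hchain : ∀ i : Fin n, A i.succ ≤ A i.castSucc)
    (B : Fin n → L.Substructure A₀.carrier)
    (hBA : ∀ i : Fin n, B i ≤ A i.castSucc)
    (P : Set (SStr.{u} L))
    (hP : P = {N : SStr.{u} L |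
      ∃ ι : Type u, Nonempty (N.carrier ↪[L] (ι → ↥(A (Fin.last n))))})
    (hA₀P : A₀ ∈ P)
    (hind : ∀ i : Fin n, PIndependentPair P A₀ (A i.succ) (B i)) :
    PIndependent P A₀ B := by
  subst hP
  rintro C ⟨ι, ⟨e⟩⟩ g
  have hcl : (⨆ i, B i) = Substructure.closure L (⋃ i, (B i : Set A₀.carrier)) := by
    rw [Substructure.closure_iUnion]
    simp
  have st := fun k : ι => aux_stage A₀ n A hchain B hBA _ hA₀P hind
    (fun i => (projHom k).comp (e.toHom.comp (g i))) n 0 (by simp)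
  choose φ hφA hφB using st
  have hle : (⨆ i, B i) ≤ Substructure.closure L (gens (A (Fin.last n)) B 0) :=
    iSup_le fun i x hx => Substructure.subset_closure (Or.inr ⟨i, Nat.zero_le _, hx⟩)
  let H := powHom fun k => (φ k).comp (Substructure.inclusion hle).toHom
  have hH : ∀ i x (hx : x ∈ B i) hx', H ⟨x, hx'⟩ = e (g i ⟨x, hx⟩) := fun i x hx hx' =>
    funext fun k => hφB k i (Nat.zero_le _) x hx _
  have hmem : ∀ x, H x ∈ e.toHom.range := by
    refine aux_mem H _ _ hcl.le fun x hx => ?_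
    obtain ⟨i, hi⟩ := Set.mem_iUnion.1 hx
    refine ⟨le_iSup B i hi, ?_⟩
    rw [hH i x hi]
    exact Hom.mem_range_self e.toHom _
  refine ⟨e.equivRange.symm.toHom.comp (H.codRestrict _ hmem), fun i => ?_, fun h' hh' => ?_⟩
  · ext ⟨x, hx⟩
    have e1 : H.codRestrict _ hmem ⟨x, le_iSup B i hx⟩ = e.equivRange (g i ⟨x, hx⟩) :=
      Subtype.ext (hH i x hx _)
    change e.equivRange.symm (H.codRestrict _ hmem ⟨x, le_iSup B i hx⟩) = _
    rw [e1]
    exact e.equivRange.symm_apply_apply _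
  · ext x
    refine aux_mem (Hom.id L _) (h'.eqLocus _) _ hcl.le (fun x hx => ?_) x
    obtain ⟨i, hi⟩ := Set.mem_iUnion.1 hx
    refine ⟨le_iSup B i hi, ?_⟩
    have e1 : H.codRestrict _ hmem ⟨x, le_iSup B i hi⟩ = e.equivRange (g i ⟨x, hi⟩) :=
      Subtype.ext (hH i x hi _)
    have e2 : h' ⟨x, le_iSup B i hi⟩ = g i ⟨x, hi⟩ := DFunLike.congr_fun (hh' i) ⟨x, hi⟩
    change h' ⟨x, le_iSup B i hi⟩ = e.equivRange.symm (H.codRestrict _ hmem ⟨x, le_iSup B i hi⟩)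
    rw [e1, e2]
    exact (e.equivRange.symm_apply_apply _).symm
end Paper
end

section
/- Let P be a prevariety of L-structures, let A be a structure in P, and let (B_i)_{i∈I} be a family of substructures of A. Suppose that every finite subset I_0 ⊆ I is contained in some subset I_1 ⊆ I such that the family (B_i)_{i∈I_1} is P-independent. Then the whole family (B_i)_{i∈I} is P-independent. -/
open FirstOrder FirstOrder.Language

universe u v w

namespace Paper

variable {L : FirstOrder.Language.{v, w}}

theorem hom_agree {M N : Type*} [L.Structure M] [L.Structure N] {J : Type*}
    (D : J → L.Substructure M) (T : L.Substructure M) (hT : T ≤ ⨆ j, D j)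
    (f g : T →[L] N)
    (hfg : ∀ j, ∀ b ∈ D j, ∃ hb : b ∈ T, f ⟨b, hb⟩ = g ⟨b, hb⟩) : f = g := by
  have h1 : (⨆ j, D j) ≤ (f.eqLocus g).map T.subtype.toHom := by
    refine iSup_le fun j b hb => ?_
    obtain ⟨hb', h⟩ := hfg j b hb
    exact ⟨⟨b, hb'⟩, h, rfl⟩
  ext x
  obtain ⟨y, hy, hyx⟩ := h1 (hT x.2)
  have : y = x := Subtype.ext hyx
  subst this
  exact hy

/-- Lemma: a family of substructures is `P`-independent provided every finite subset of the
index set is contained in a subset indexing a `P`-independent subfamily. -/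
theorem independent_of_finite_subsets_independent
    {L : FirstOrder.Language.{v, w}} (P : Set (SStr.{u} L)) (hP : IsPrevariety P)
    (A : SStr.{u} L) (hA : A ∈ P) {I : Type*} (B : I → L.Substructure A.carrier)
    (h : ∀ I₀ : Set I, I₀.Finite → ∃ I₁ : Set I, I₀ ⊆ I₁ ∧
      PIndependent P A fun i : I₁ => B i.1) :
    PIndependent P A B := by
  classical
  intro C hC g
  let S : Finset I → L.Substructure A.carrier := fun F => ⨆ i : F, B i.1
  have hBS : ∀ (F : Finset I) (i : I), i ∈ F → B i ≤ S F := fun F i hi =>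
    le_iSup (fun i : F => B i.1) ⟨i, hi⟩
  have hmono : ∀ F G : Finset I, F ⊆ G → S F ≤ S G := fun F G hFG =>
    iSup_le fun i => hBS G i.1 (hFG i.2)
  have hex : ∀ F : Finset I, ∃ k : S F →[L] C.carrier,
      ∀ (i : I) (hi : i ∈ F) (b : A.carrier) (hb : b ∈ B i),
        k ⟨b, hBS F i hi hb⟩ = g i ⟨b, hb⟩ := by
    intro F
    obtain ⟨I₁, hI, hind⟩ := h F F.finite_toSet
    obtain ⟨k, hk, -⟩ := hind C hC fun i => g i.1
    have hle : S F ≤ ⨆ i : I₁, B i.1 :=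
      iSup_le fun i => le_iSup (fun i : I₁ => B i.1) ⟨i.1, hI i.2⟩
    refine ⟨k.comp (Substructure.inclusion hle).toHom, fun i hi b hb => ?_⟩
    exact DFunLike.congr_fun (hk ⟨i, hI hi⟩) ⟨b, hb⟩
  choose k hk using hex
  have hcompat : ∀ (F G : Finset I), F ⊆ G → ∀ (x : A.carrier) (hF : x ∈ S F) (hG : x ∈ S G),
      k F ⟨x, hF⟩ = k G ⟨x, hG⟩ := by
    intro F G hFG x hF hG
    have : k F = (k G).comp (Substructure.inclusion (hmono F G hFG)).toHom := by
      refine hom_agree (fun i : F => B i.1) (S F) le_rfl _ _ fun i b hb => ?_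
      refine ⟨hBS F i.1 i.2 hb, ?_⟩
      rw [hk F i.1 i.2 b hb]
      exact (hk G i.1 (hFG i.2) b hb).symm
    exact DFunLike.congr_fun this ⟨x, hF⟩
  have htup : ∀ (n : ℕ) (F : Fin n → Finset I), ∃ G : Finset I, ∀ j, F j ⊆ G := fun n F =>
    ⟨Finset.univ.biUnion F, fun j => Finset.subset_biUnion_of_mem F (Finset.mem_univ j)⟩
  let U : L.Substructure A.carrier :=
    { carrier := {x | ∃ F, x ∈ S F}
      fun_mem := by
        intro n f xs hxs
        choose F hF using hxs
        obtain ⟨G, hG⟩ := htup n F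
        exact ⟨G, (S G).fun_mem f xs fun j => hmono _ _ (hG j) (hF j)⟩ }
  have hU : (⨆ i, B i) ≤ U := iSup_le fun i b hb =>
    ⟨{i}, hBS {i} i (Finset.mem_singleton_self i) hb⟩
  have hU' : ∀ x : ↥(⨆ i, B i), ∃ F, x.1 ∈ S F := fun x => hU x.2
  choose φ hφ using hU'
  have hval : ∀ (x : ↥(⨆ i, B i)) (G : Finset I) (hG : x.1 ∈ S G),
      k (φ x) ⟨x.1, hφ x⟩ = k G ⟨x.1, hG⟩ := by
    intro x G hG
    rw [hcompat (φ x) (φ x ∪ G) Finset.subset_union_left x.1 (hφ x)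
        (hmono _ _ Finset.subset_union_left (hφ x)),
      hcompat G (φ x ∪ G) Finset.subset_union_right x.1 hG
        (hmono _ _ Finset.subset_union_left (hφ x))]
  let H : ↥(⨆ i, B i) →[L] C.carrier :=
    { toFun := fun x => k (φ x) ⟨x.1, hφ x⟩
      map_fun' := by
        intro n f xs
        obtain ⟨G, hG⟩ := htup n fun j => φ (xs j)
        have hm : ∀ j, (xs j).1 ∈ S G := fun j => hmono _ _ (hG j) (hφ (xs j))
        have h1 := (k G).map_fun f fun j => (⟨(xs j).1, hm j⟩ : S G)
        have h2 : (fun j => k (φ (xs j)) ⟨(xs j).1, hφ (xs j)⟩)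
            = fun j => k G ⟨(xs j).1, hm j⟩ := funext fun j => hval (xs j) G (hm j)
        refine (hval _ G ((S G).fun_mem f _ hm)).trans ?_
        refine Eq.trans ?_ (h1.trans (congrArg (Structure.funMap f) h2.symm))
        rfl
      map_rel' := by
        intro n r xs hr
        obtain ⟨G, hG⟩ := htup n fun j => φ (xs j)
        have hm : ∀ j, (xs j).1 ∈ S G := fun j => hmono _ _ (hG j) (hφ (xs j))
        have h1 := (k G).map_rel r (fun j => (⟨(xs j).1, hm j⟩ : S G)) hr
        have h2 : (fun j => k (φ (xs j)) ⟨(xs j).1, hφ (xs j)⟩)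
            = fun j => k G ⟨(xs j).1, hm j⟩ := funext fun j => hval (xs j) G (hm j)
        change Structure.RelMap r (fun j => k (φ (xs j)) ⟨(xs j).1, hφ (xs j)⟩)
        rw [h2]
        exact h1 }
  refine ⟨H, fun i => ?_, fun H' hH' => ?_⟩
  · ext b
    have hi := Finset.mem_singleton_self i
    exact (hval ⟨b.1, le_iSup B i b.2⟩ {i} (hBS {i} i hi b.2)).trans (hk {i} i hi b.1 b.2)
  · refine hom_agree B _ le_rfl _ _ fun i b hb => ⟨le_iSup B i hb, ?_⟩
    have hi := Finset.mem_singleton_self i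
    refine (DFunLike.congr_fun (hH' i) ⟨b, hb⟩).trans ?_
    exact ((hval ⟨b, le_iSup B i hb⟩ {i} (hBS {i} i hi hb)).trans (hk {i} i hi b hb)).symm
end Paper
end

section
/- Let A be an L-structure, let P be the prevariety generated by A, let n be a natural number, and let B_1, …, B_n be structures in P. Suppose that for each i ∈ {1,…,n} there are homomorphisms u_i : A → A and v_i : B_i → A such that the pair (u_i, v_i) realizes the coproduct of the pair (A, B_i) in P inside A. Then there exist homomorphisms w_1 : B_1 → A, …, w_n : B_n → A such that the family (w_i)_{i=1,…,n} realizes the coproduct of the family (B_1, …, B_n) in P inside A (i.e., A contains an isomorphic copy of the coproduct of B_1, …, B_n in P). -/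
open FirstOrder FirstOrder.Language

universe u v w

namespace Paper

variable {L : FirstOrder.Language.{v, w}}

theorem self_mem {L : FirstOrder.Language.{v, w}} (A : SStr.{u} L) :
    MemGenPrevariety (fun _ : Unit => A) A :=
  ⟨PUnit, fun _ => (), ⟨{
    toFun := fun a _ => a
    inj' := fun a b hab => congrFun hab PUnit.unit
    map_fun' := fun _ _ => rfl
    map_rel' := fun _ _ => ⟨fun hr => hr PUnit.unit, fun hr _ => hr⟩ }⟩⟩

theorem chain_aux {L : FirstOrder.Language.{v, w}} (A : SStr.{u} L)
    (P : Set (SStr.{u} L)) (hA : A ∈ P) (n : ℕ) :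
    ∀ (B : Fin n → SStr.{u} L)
    (_ : ∀ i, ∃ (u' : A.carrier →[L] A.carrier) (v : (B i).carrier →[L] A.carrier),
      RealizesCoproductPair P A A (B i) u' v),
    ∃ (e : A.carrier →[L] A.carrier) (w : ∀ i, (B i).carrier →[L] A.carrier),
      ∀ g : ∀ i, (B i).carrier →[L] A.carrier,
        ∃ (S : L.Substructure A.carrier) (k : S →[L] A.carrier),
          (∀ a, ∃ hm : e a ∈ S, k ⟨e a, hm⟩ = a) ∧
          ∀ i b, ∃ hm : w i b ∈ S, k ⟨w i b, hm⟩ = g i b := by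
  induction n with
  | zero =>
    intro B _
    refine ⟨Hom.id L _, fun i => i.elim0, fun g => ⟨⊤, (⊤ : L.Substructure A.carrier).subtype.toHom,
      fun a => ⟨trivial, rfl⟩, fun i => i.elim0⟩⟩
  | succ n ih =>
    intro B h
    obtain ⟨e, w, hw⟩ := ih (fun i => B i.succ) (fun i => h i.succ)
    obtain ⟨u, v, huv⟩ := h 0
    refine ⟨u.comp e, Fin.cons (α := fun i => (B i).carrier →[L] A.carrier) v
      (fun i => u.comp (w i)), fun g => ?_⟩
    obtain ⟨S, k, hk1, hk2⟩ := hw (fun i => g i.succ)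
    obtain ⟨f, ⟨hf1, hf2⟩, -⟩ := huv A hA (Hom.id L _) (e.comp (g 0))
    let T := (S.comap f).map (u.range ⊔ v.range).subtype.toHom
    have hT : ∀ x : T, ∃ hm : x.1 ∈ u.range ⊔ v.range, f ⟨x.1, hm⟩ ∈ S := by
      rintro ⟨x, ⟨y, hy⟩, hS, rfl⟩
      exact ⟨hy, hS⟩
    let q : T →[L] S :=
      { toFun := fun x => ⟨f ⟨x.1, (hT x).1⟩, (hT x).2⟩
        map_fun' := fun F x => Subtype.ext
          (f.map_fun F (fun i => (⟨(x i).1, (hT (x i)).1⟩ : ↥(u.range ⊔ v.range))))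
        map_rel' := fun R x hr =>
          f.map_rel R (fun i => (⟨(x i).1, (hT (x i)).1⟩ : ↥(u.range ⊔ v.range))) hr }
    have key : ∀ (x : A.carrier) (hm : x ∈ u.range ⊔ v.range) (y : A.carrier) (z : A.carrier)
        (_ : f ⟨x, hm⟩ = y) (_ : ∃ hy : y ∈ S, k ⟨y, hy⟩ = z),
        ∃ hm : x ∈ T, (k.comp q) ⟨x, hm⟩ = z := by
      rintro x hm y z rfl ⟨hy, rfl⟩
      exact ⟨⟨⟨x, hm⟩, hy, rfl⟩, rfl⟩
    refine ⟨T, k.comp q, fun a => ?_, fun i => ?_⟩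
    · exact key _ _ _ _ (hf1 (e a)) (hk1 a)
    · refine Fin.cases ?_ (fun i => ?_) i
      · intro b
        exact key _ _ _ _ (hf2 b) (hk1 (g 0 b))
      · intro b
        exact key _ _ _ _ (hf1 (w i b)) (hk2 i b)

/-- Corollary: if `A` generates `P` and contains a copy of `A ∐ Bᵢ` for each of finitely many
`Bᵢ` in `P`, then `A` contains a copy of the coproduct of the `Bᵢ` in `P`. -/
theorem contains_finite_coproduct
    {L : FirstOrder.Language.{v, w}} (A : SStr.{u} L)
    (P : Set (SStr.{u} L))
    (hP : P = {N : SStr.{u} L | MemGenPrevariety (fun _ : Unit => A) N})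
    (n : ℕ) (B : Fin n → SStr.{u} L) (hB : ∀ i, B i ∈ P)
    (h : ∀ i, ∃ (u' : A.carrier →[L] A.carrier) (v : (B i).carrier →[L] A.carrier),
      RealizesCoproductPair P A A (B i) u' v) :
    ∃ w : ∀ i, (B i).carrier →[L] A.carrier, RealizesCoproduct P A B w := by
  subst hP
  obtain ⟨e, w, hw⟩ := chain_aux A _ (self_mem A) n B h
  refine ⟨w, ?_⟩
  rintro C ⟨ι, c, ⟨φ⟩⟩ g
  let π : ∀ j : ι, C.carrier →[L] A.carrier := fun j =>
    { toFun := fun x => φ x j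
      map_fun' := fun F x => congrFun (φ.map_fun F x) j
      map_rel' := fun R x hr => (φ.map_rel R x).2 hr j }
  choose S k _ hk using fun j => hw (fun i => (π j).comp (g i))
  set D : L.Substructure A.carrier := ⨆ i, (w i).range with hD
  have hmem : ∀ i b, w i b ∈ D := fun i b =>
    SetLike.le_def.mp (le_iSup (fun i => (w i).range) i) (Hom.mem_range_self (w i) b)
  have hDS : ∀ j, D ≤ S j := fun j => iSup_le fun i => by
    rintro _ ⟨b, rfl⟩
    exact (hk j i b).1
  have ind : ∀ E : L.Substructure D, (∀ i b, (⟨w i b, hmem i b⟩ : D) ∈ E) → ∀ x, x ∈ E := by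
    intro E hE x
    have : D ≤ E.map D.subtype.toHom := iSup_le fun i => by
      rintro _ ⟨b, rfl⟩
      exact ⟨⟨w i b, hmem i b⟩, hE i b, rfl⟩
    obtain ⟨y, hy, hyx⟩ := this x.2
    have : y = x := Subtype.ext hyx
    exact this ▸ hy
  let H : D →[L] (∀ _ : ι, A.carrier) :=
    { toFun := fun x j => k j ⟨x.1, hDS j x.2⟩
      map_fun' := fun F x => funext fun j =>
        (k j).map_fun F (fun i => (⟨(x i).1, hDS j (x i).2⟩ : S j))
      map_rel' := fun R x hr j =>
        (k j).map_rel R (fun i => (⟨(x i).1, hDS j (x i).2⟩ : S j)) hr }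
  have hH : ∀ i b, H ⟨w i b, hmem i b⟩ = φ (g i b) := fun i b =>
    funext fun j => (hk j i b).2
  have hr : ∀ x : D, ∃ y, φ y = H x := by
    intro x
    exact ind (φ.toHom.range.comap H) (fun i b => ⟨g i b, (hH i b).symm⟩) x
  choose r hr using hr
  let G : D →[L] C.carrier :=
    { toFun := r
      map_fun' := fun F x => φ.injective <| by
        rw [hr, φ.map_fun, H.map_fun]
        congr 1
        funext i
        exact (hr (x i)).symm
      map_rel' := fun R x hx => (φ.map_rel R _).1 <| by
        have := H.map_rel R x hx
        have e2 : φ ∘ (r ∘ x) = H ∘ x := funext fun i => hr (x i)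
        rw [e2]
        exact this }
  have hG : ∀ i b, G ⟨w i b, hmem i b⟩ = g i b := fun i b =>
    φ.injective ((hr _).trans (hH i b))
  refine ⟨G, hG, fun G' hG' => ?_⟩
  ext x
  exact ind (G'.eqLocus G) (fun i b => (hG' i b).trans (hG i b).symm) x
end Paper
end

section
/- Let A be an L-structure, let P be the prevariety generated by A, and let (B_i)_{i∈ℕ} be a countable family of structures in P. Suppose that for each i ∈ ℕ there are homomorphisms u_i : A → A and v_i : B_i → A such that the pair (u_i, v_i) realizes the coproduct of the pair (A, B_i) in P inside A. Then there exists a family of homomorphisms w_i : B_i → A (i ∈ ℕ) realizing the coproduct of the countable family (B_i)_{i∈ℕ} in P inside A (i.e., A contains an isomorphic copy of the coproduct in P of the countably many structures B_i). -/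
open FirstOrder FirstOrder.Language

universe u v w

namespace Paper

variable {L : FirstOrder.Language.{v, w}}

section helpers
variable {M N : Type*} [L.Structure M] [L.Structure N]

/-- Two partial homomorphisms agreeing on generators agree. -/
theorem agree {I : Sort*} {T : I → Type*} [∀ i, L.Structure (T i)] (f : ∀ i, T i →[L] M)
    (S₁ S₂ : L.Substructure M) (h₁ : S₁ →[L] N) (h₂ : S₂ →[L] N)
    (hg : ∀ i b, ∃ (p : f i b ∈ S₁) (q : f i b ∈ S₂), h₁ ⟨_, p⟩ = h₂ ⟨_, q⟩)
    (x : M) (hx : x ∈ ⨆ i, (f i).range) (p : x ∈ S₁) (q : x ∈ S₂) : h₁ ⟨x, p⟩ = h₂ ⟨x, q⟩ := by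
  let E : L.Substructure M :=
    { carrier := {x | ∃ (p : x ∈ S₁) (q : x ∈ S₂), h₁ ⟨x, p⟩ = h₂ ⟨x, q⟩}
      fun_mem := by
        intro n F xs hxs
        choose p q e using hxs
        refine ⟨S₁.fun_mem F xs p, S₂.fun_mem F xs q, ?_⟩
        have a := h₁.map_fun F (fun i => ⟨xs i, p i⟩)
        have b := h₂.map_fun F (fun i => ⟨xs i, q i⟩)
        refine a.trans (Eq.trans ?_ b.symm)
        congr 1
        funext i
        exact e i }
  have hE : (⨆ i, (f i).range) ≤ E := by
    refine iSup_le fun i => ?_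
    rintro _ ⟨b, rfl⟩
    exact hg i b
  obtain ⟨_, _, e⟩ := hE hx
  exact e

/-- Composition of partial homomorphisms. -/
theorem pcomp {K : Type*} [L.Structure K] (S₀ : L.Substructure M) (r : S₀ →[L] N)
    (S' : L.Substructure N) (h' : S' →[L] K) :
    ∃ (S : L.Substructure M) (h : S →[L] K), ∀ (x : M) (hx : x ∈ S₀) (y : N) (hy : y ∈ S'),
      r ⟨x, hx⟩ = y → ∃ hS : x ∈ S, h ⟨x, hS⟩ = h' ⟨y, hy⟩ := by
  let S : L.Substructure M :=
    { carrier := {x | ∃ p : x ∈ S₀, r ⟨x, p⟩ ∈ S'}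
      fun_mem := by
        intro n F xs hxs
        choose p q using hxs
        refine ⟨S₀.fun_mem F xs p, ?_⟩
        have a := r.map_fun F (fun i => ⟨xs i, p i⟩)
        have b := S'.fun_mem F _ q
        exact (congrArg (· ∈ S') a).mpr b }
  have p : ∀ x : S, x.1 ∈ S₀ := fun x => x.2.1
  have q : ∀ x : S, r ⟨x.1, p x⟩ ∈ S' := fun x => x.2.2
  refine ⟨S, { toFun := fun x => h' ⟨r ⟨x.1, p x⟩, q x⟩, map_fun' := ?_, map_rel' := ?_ }, ?_⟩
  · intro n F xs
    have a := r.map_fun F (fun i => ⟨(xs i).1, p (xs i)⟩)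
    have b := h'.map_fun F (fun i => ⟨r ⟨(xs i).1, p (xs i)⟩, q (xs i)⟩)
    refine Eq.trans ?_ b
    congr 1
    exact Subtype.ext a
  · intro n R xs hR
    have a := r.map_rel R (fun i => ⟨(xs i).1, p (xs i)⟩) hR
    exact h'.map_rel R (fun i => ⟨r ⟨(xs i).1, p (xs i)⟩, q (xs i)⟩) a
  · rintro x hx y hy rfl
    exact ⟨⟨hx, hy⟩, rfl⟩

/-- The composite `u 0 ∘ ⋯ ∘ u (n-1)`. -/
def compU (n : ℕ) : (ℕ → (M →[L] M)) → (M →[L] M) :=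
  match n with
  | 0 => fun _ => Hom.id L M
  | n + 1 => fun u' => (u' 0).comp (compU n fun i => u' (i + 1))

/-- The map `u 0 ∘ ⋯ ∘ u (n-1) ∘ v n`. -/
def compW (n : ℕ) : (B : ℕ → SStr.{u} L) → (ℕ → (M →[L] M)) →
    (∀ i, (B i).carrier →[L] M) → ((B n).carrier →[L] M) :=
  match n with
  | 0 => fun _ _ v' => v' 0
  | n + 1 => fun B u' v' =>
      (u' 0).comp (compW n (fun i => B (i + 1)) (fun i => u' (i + 1)) fun i => v' (i + 1))

end helpers

theorem finite_stage {A : SStr.{u} L} {P : Set (SStr.{u} L)} (hA : A ∈ P) (N : ℕ) :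
    ∀ (B : ℕ → SStr.{u} L) (u' : ℕ → (A.carrier →[L] A.carrier))
      (v' : ∀ i, (B i).carrier →[L] A.carrier)
      (_ : ∀ i, RealizesCoproductPair P A A (B i) (u' i) (v' i))
      (g : ∀ i, (B i).carrier →[L] A.carrier),
      ∃ (S : L.Substructure A.carrier) (h : S →[L] A.carrier),
        (∀ a, ∃ p : compU N u' a ∈ S, h ⟨_, p⟩ = a) ∧
        (∀ i < N, ∀ b, ∃ p : compW i B u' v' b ∈ S, h ⟨_, p⟩ = g i b) := by
  induction N with
  | zero =>
    intro B u' v' hr g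
    refine ⟨⊤, (⊤ : L.Substructure A.carrier).subtype.toHom, fun a => ⟨trivial, rfl⟩, ?_⟩
    intro i hi
    exact absurd hi (Nat.not_lt_zero i)
  | succ N ih =>
    intro B u' v' hr g
    obtain ⟨S', h', hU, hW⟩ := ih (fun i => B (i + 1)) (fun i => u' (i + 1))
      (fun i => v' (i + 1)) (fun i => hr (i + 1)) (fun i => g (i + 1))
    obtain ⟨r, ⟨hr1, hr2⟩, -⟩ := hr 0 A hA (Hom.id L A.carrier)
      ((compU N fun i => u' (i + 1)).comp (g 0))
    obtain ⟨S, h, hS⟩ := pcomp _ r S' h'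
    refine ⟨S, h, ?_, ?_⟩
    · intro a
      obtain ⟨p, e⟩ := hU a
      obtain ⟨q, e'⟩ := hS _ _ _ p (hr1 (compU N (fun i => u' (i + 1)) a))
      exact ⟨q, e'.trans e⟩
    · intro i hi b
      cases i with
      | zero =>
        obtain ⟨p, e⟩ := hU (g 0 b)
        obtain ⟨q, e'⟩ := hS _ _ _ p (hr2 b)
        exact ⟨q, e'.trans e⟩
      | succ i =>
        obtain ⟨p, e⟩ := hW i (by omega) b
        obtain ⟨q, e'⟩ := hS _ _ _ p (hr1 _)
        exact ⟨q, e'.trans e⟩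

/-- Gluing finite stages. -/
theorem glue {M N : Type*} [L.Structure M] [L.Structure N] {T : ℕ → Type*}
    [∀ i, L.Structure (T i)] (f : ∀ i, T i →[L] M) (g : ∀ i, T i →[L] N)
    (H : ∀ n : ℕ, ∃ (S : L.Substructure M) (h : S →[L] N),
      ∀ i < n, ∀ b, ∃ p : f i b ∈ S, h ⟨_, p⟩ = g i b) :
    ∃ h : ↥(⨆ i, (f i).range) →[L] N, ∀ i b (p : f i b ∈ ⨆ i, (f i).range),
      h ⟨f i b, p⟩ = g i b := by
  choose S h hh using H
  let D : ℕ → L.Substructure M := fun n => ⨆ i : Fin n, (f i).range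
  have Dmono : Monotone D := by
    intro m n hmn
    exact iSup_le fun i => le_iSup (fun j : Fin n => (f j).range) (Fin.castLE hmn i)
  have DS : ∀ n m, n ≤ m → D n ≤ S m := by
    intro n m hnm
    refine iSup_le fun i => ?_
    rintro _ ⟨b, rfl⟩
    exact (hh m i (lt_of_lt_of_le i.2 hnm) b).1
  have key : ∀ n m (hnm : n ≤ m) x (hx : x ∈ D n),
      h n ⟨x, DS n n le_rfl hx⟩ = h m ⟨x, DS n m hnm hx⟩ := by
    intro n m hnm x hx
    refine agree (fun i : Fin n => f i) _ _ (h n) (h m) ?_ x hx _ _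
    intro i b
    obtain ⟨p, e⟩ := hh n i i.2 b
    obtain ⟨q, e'⟩ := hh m i (lt_of_lt_of_le i.2 hnm) b
    exact ⟨p, q, e.trans e'.symm⟩
  let Z : L.Substructure M :=
    { carrier := {x | ∃ n, x ∈ D n}
      fun_mem := by
        intro n F xs hxs
        choose k hk using hxs
        obtain ⟨m, hm⟩ := Finite.exists_le k
        exact ⟨m, (D m).fun_mem F xs fun i => Dmono (hm i) (hk i)⟩ }
  have hZ : (⨆ i, (f i).range) ≤ Z := by
    refine iSup_le fun i => ?_
    intro x hx
    exact ⟨i + 1, le_iSup (fun j : Fin (i + 1) => (f j).range) (Fin.last i) hx⟩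
  have hZ' : ∀ x : ↥(⨆ i, (f i).range), ∃ n, x.1 ∈ D n := fun x => hZ x.2
  choose k hk using hZ'
  have val : ∀ (x : ↥(⨆ i, (f i).range)) n (hx : x.1 ∈ S n), k x ≤ n →
      h (k x) ⟨x.1, DS _ _ le_rfl (hk x)⟩ = h n ⟨x.1, hx⟩ :=
    fun x n hx hkn => key _ _ hkn _ (hk x)
  refine ⟨{ toFun := fun x => h (k x) ⟨x.1, DS _ _ le_rfl (hk x)⟩,
            map_fun' := ?_, map_rel' := ?_ }, ?_⟩
  · intro n F xs
    obtain ⟨m, hm⟩ := Finite.exists_le (fun i => k (xs i))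
    let m' := max m (k (Structure.funMap F xs))
    have hx : ∀ i, (xs i).1 ∈ S m' := fun i => DS _ _ ((hm i).trans (le_max_left _ _)) (hk _)
    have hF := (S m').fun_mem F _ hx
    refine (val _ m' hF (le_max_right _ _)).trans ?_
    refine ((h m').map_fun F (fun i => ⟨(xs i).1, hx i⟩)).trans ?_
    congr 1
    funext i
    exact (val (xs i) m' (hx i) ((hm i).trans (le_max_left _ _))).symm
  · intro n R xs hR
    obtain ⟨m, hm⟩ := Finite.exists_le (fun i => k (xs i))
    have hx : ∀ i, (xs i).1 ∈ S m := fun i => DS _ _ (hm i) (hk _)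
    have a := (h m).map_rel R (fun i => ⟨(xs i).1, hx i⟩) hR
    convert a using 1
    funext i
    exact val (xs i) m (hx i) (hm i)
  · intro i b p
    let m := max (i + 1) (k ⟨f i b, p⟩)
    obtain ⟨q, e⟩ := hh m i (lt_of_lt_of_le (Nat.lt_succ_self i) (le_max_left _ _)) b
    exact (val ⟨f i b, p⟩ m q (le_max_right _ _)).trans e

/-- Corollary: if `A` generates `P` and contains a copy of `A ∐ Bᵢ` for each member of a
countable family in `P`, then `A` contains a copy of the coproduct of all the `Bᵢ` in `P`. -/
theorem contains_countable_coproduct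
    {L : FirstOrder.Language.{v, w}} (A : SStr.{u} L)
    (P : Set (SStr.{u} L))
    (hP : P = {N : SStr.{u} L | MemGenPrevariety (fun _ : Unit => A) N})
    (B : ℕ → SStr.{u} L) (hB : ∀ i, B i ∈ P)
    (h : ∀ i : ℕ, ∃ (u' : A.carrier →[L] A.carrier) (v : (B i).carrier →[L] A.carrier),
      RealizesCoproductPair P A A (B i) u' v) :
    ∃ w : ∀ i : ℕ, (B i).carrier →[L] A.carrier, RealizesCoproduct P A B w := by
  have hA : A ∈ P := by
    rw [hP]
    refine ⟨PUnit, fun _ => (), ⟨{ toFun := fun a _ => a, inj' := ?_, map_fun' := ?_, map_rel' := ?_ }⟩⟩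
    · intro a b e
      exact congrFun e PUnit.unit
    · intro n F x
      rfl
    · intro n R x
      exact ⟨fun t => t PUnit.unit, fun t _ => t⟩
  choose u' v' hr using h
  refine ⟨fun i => compW i B u' v', ?_⟩
  intro C hC g
  rw [hP] at hC
  obtain ⟨ι, f, ⟨φ⟩⟩ := hC
  have H : ∀ j : ι, ∃ h : ↥(⨆ i, (compW i B u' v').range) →[L] A.carrier,
      ∀ i b (p : compW i B u' v' b ∈ ⨆ i, (compW i B u' v').range),
      h ⟨compW i B u' v' b, p⟩ = φ (g i b) j := by
    intro j
    let gj : ∀ i, (B i).carrier →[L] A.carrier := fun i =>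
      { toFun := fun b => φ (g i b) j
        map_fun' := by
          intro n F x
          have := φ.toHom.map_fun F (g i ∘ x)
          rw [(g i).map_fun F x]
          exact congrFun this j
        map_rel' := by
          intro n R x hR
          exact φ.toHom.map_rel R _ ((g i).map_rel R x hR) j }
    refine glue (fun i => compW i B u' v') gj fun n => ?_
    obtain ⟨S, h, -, hh⟩ := finite_stage hA n B u' v' hr gj
    exact ⟨S, h, hh⟩
  choose k hk using H
  let K : ↥(⨆ i, (compW i B u' v').range) → (∀ j : ι, A.carrier) := fun x j => k j x
  let Z : L.Substructure A.carrier :=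
    { carrier := {x | ∃ (p : x ∈ ⨆ i, (compW i B u' v').range) (c : C.carrier), φ c = K ⟨x, p⟩}
      fun_mem := by
        intro n F xs hxs
        choose p c e using hxs
        refine ⟨(⨆ i, (compW i B u' v').range).fun_mem F xs p, Structure.funMap F c, ?_⟩
        rw [φ.map_fun]
        funext j
        have := (k j).map_fun F (fun i => ⟨xs i, p i⟩)
        refine Eq.trans ?_ this.symm
        change Structure.funMap F _ = _
        congr 1
        funext i
        exact congrFun (e i) j }
  have hZ : (⨆ i, (compW i B u' v').range) ≤ Z := by
    refine iSup_le fun i => ?_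
    rintro _ ⟨b, rfl⟩
    have p := SetLike.le_def.mp (le_iSup (fun i => (compW i B u' v').range) i)
      (Hom.mem_range_self (compW i B u' v') b)
    exact ⟨p, g i b, funext fun j => (hk j i b p).symm⟩
  have hZ' : ∀ x : ↥(⨆ i, (compW i B u' v').range), ∃ c : C.carrier, φ c = K x :=
    fun x => (hZ x.2).2
  choose q hq using hZ'
  have hex : ∃ h : ↥(⨆ i, (compW i B u' v').range) →[L] C.carrier,
      ∀ i b (p : compW i B u' v' b ∈ ⨆ i, (compW i B u' v').range),
      h ⟨compW i B u' v' b, p⟩ = g i b := by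
    refine ⟨{ toFun := q, map_fun' := ?_, map_rel' := ?_ }, ?_⟩
    · intro n F xs
      apply φ.injective
      rw [hq, φ.map_fun]
      funext j
      refine ((k j).map_fun F xs).trans ?_
      change _ = Structure.funMap F _
      congr 1
      funext i
      exact (congrFun (hq (xs i)) j).symm
    · intro n R xs hR
      rw [← φ.map_rel]
      intro j
      have := (k j).map_rel R xs hR
      convert this using 1
      funext i
      exact congrFun (hq (xs i)) j
    · intro i b p
      apply φ.injective
      refine (hq _).trans ?_
      funext j
      exact hk j i b _
  obtain ⟨h₀, hh₀⟩ := hex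
  refine ⟨h₀, fun i b => hh₀ i b _, ?_⟩
  intro h' hh'
  ext x
  refine agree (fun i => compW i B u' v') _ _ h' h₀ ?_ x.1 x.2 x.2 x.2
  intro i b
  have p := SetLike.le_def.mp (le_iSup (fun i => (compW i B u' v').range) i)
    (Hom.mem_range_self (compW i B u' v') b)
  exact ⟨p, p, (hh' i b).trans (hh₀ i b p).symm⟩
end Paper
end

section
/- Let C be a category and U : C ⥤ Type* a functor, and call a morphism f of C one-to-one if U.map f is injective. Assume that for every pair of one-to-one morphisms of C with a common domain, a pushout exists in C. Then the following are equivalent: (a) the amalgamation property: for all objects A, B, C and one-to-one morphisms f : A → B and g : A → C there exist an object D and one-to-one morphisms f' : B → D and g' : C → D with f ≫ f' = g ≫ g'; (b) for all objects S, T, A, B and one-to-one morphisms s : S → T, a : S → A, and f : A → B, the canonical morphism from the pushout of (a, s) to the pushout of (a ≫ f, s) induced by f and the identity of T is one-to-one. -/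
open CategoryTheory CategoryTheory.Limits

universe u v w

/-- For a category `C` with a functor `U : C ⥤ Type*`, admitting pushouts of pairs of
one-to-one morphisms (morphisms sent to injections by `U`), the amalgamation property is
equivalent to the statement that pushing out a one-to-one morphism `f : A ⟶ B` along any
span `T ↢ S ↣ A` of one-to-one morphisms yields a one-to-one morphism
`A ⨿_S T ⟶ B ⨿_S T`. -/
theorem amalgamation_iff_pushout_preserves_injective
    {C : Type u} [Category.{v} C] (U : C ⥤ Type w)
    (hpo : ∀ ⦃X A B : C⦄ (f : X ⟶ A) (g : X ⟶ B),
      Function.Injective (U.map f) → Function.Injective (U.map g) → HasPushout f g) :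
    (∀ ⦃A B E : C⦄ (f : A ⟶ B) (g : A ⟶ E),
        Function.Injective (U.map f) → Function.Injective (U.map g) →
        ∃ (D : C) (f' : B ⟶ D) (g' : E ⟶ D),
          Function.Injective (U.map f') ∧ Function.Injective (U.map g') ∧
            f ≫ f' = g ≫ g')
    ↔ (∀ ⦃S T A B : C⦄ (s : S ⟶ T) (a : S ⟶ A) (f : A ⟶ B),
        Function.Injective (U.map s) → Function.Injective (U.map a) →
        Function.Injective (U.map f) →
        ∀ [HasPushout a s] [HasPushout (a ≫ f) s],
          Function.Injective (U.map
            (pushout.map a s (a ≫ f) s f (𝟙 T) (𝟙 S) (by simp) (by simp)))) := by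
  have inj_of : ∀ {X Y Z : C} (p : X ⟶ Y) (q : Y ⟶ Z) (r : X ⟶ Z), p ≫ q = r →
      Function.Injective (U.map r) → Function.Injective (U.map p) := by
    intro X Y Z p q r h hr x y hxy
    apply hr
    rw [← h]
    simp [hxy]
  have inj_comp : ∀ {X Y Z : C} (p : X ⟶ Y) (q : Y ⟶ Z), Function.Injective (U.map p) →
      Function.Injective (U.map q) → Function.Injective (U.map (p ≫ q)) := by
    intro X Y Z p q hp hq x y hxy
    apply hp
    apply hq
    simpa using hxy
  have inj_id : ∀ X : C, Function.Injective (U.map (𝟙 X)) := by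
    intro X x y hxy
    simpa using hxy
  constructor
  · intro ap S T A B s a f hs ha hf _ _
    have hinl : Function.Injective (U.map (pushout.inl a s)) := by
      obtain ⟨D, a', s', h1, h2, h3⟩ := ap a s ha hs
      exact inj_of _ (pushout.desc a' s' h3) a' (pushout.inl_desc _ _ _) h1
    obtain ⟨D, f', g', h1, h2, h3⟩ := ap f (pushout.inl a s) hf hinl
    refine inj_of _ (pushout.desc f' (pushout.inr a s ≫ g') ?_) g' ?_ h2
    · rw [Category.assoc, h3, pushout.condition_assoc]
    · apply pushout.hom_ext
      · rw [pushout.map, pushout.inl_desc_assoc, Category.assoc, pushout.inl_desc, h3]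
      · rw [pushout.map, pushout.inr_desc_assoc, Category.assoc, pushout.inr_desc,
          Category.id_comp]
  · intro hb
    have key : ∀ {A B E : C} (f : A ⟶ B) (g : A ⟶ E), Function.Injective (U.map f) →
        Function.Injective (U.map g) → ∀ [HasPushout (𝟙 A ≫ f) g],
        Function.Injective (U.map (pushout.inr (𝟙 A ≫ f) g)) := by
      intro A B E f g hf hg _
      have := hpo (𝟙 A) g (inj_id A) hg
      have h := hb g (𝟙 A) f hg (inj_id A) hf
      have h1 : Function.Injective (U.map (pushout.inr (𝟙 A) g)) :=
        inj_of _ (pushout.desc g (𝟙 E) (by simp)) (𝟙 E) (pushout.inr_desc _ _ _) (inj_id E)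
      have h2 := inj_comp _ _ h1 h
      rw [pushout.map, pushout.inr_desc, Category.id_comp (pushout.inr (𝟙 A ≫ f) g)] at h2
      exact h2
    intro A B E f g hf hg
    have := hpo f g hf hg
    have : HasPushout (𝟙 A ≫ f) g := hpo _ _ (by simpa using hf) hg
    have : HasPushout (𝟙 A ≫ g) f := hpo _ _ (by simpa using hg) hf
    refine ⟨pushout f g, pushout.inl f g, pushout.inr f g, ?_, ?_, pushout.condition⟩
    · refine inj_of _ (pushout.desc (pushout.inr (𝟙 A ≫ g) f) (pushout.inl (𝟙 A ≫ g) f) ?_) _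
        (pushout.inl_desc _ _ _) (key g f hg hf)
      rw [← pushout.condition]; simp
    · refine inj_of _ (pushout.desc (pushout.inl (𝟙 A ≫ f) g) (pushout.inr (𝟙 A ≫ f) g) ?_) _
        (pushout.inr_desc _ _ _) (key f g hf hg)
      rw [← pushout.condition]; simp
end

section
/- Let C be a category and U : C ⥤ Type* a functor, and call a morphism f of C one-to-one if U.map f is injective. Assume that for every pair of one-to-one morphisms of C with a common domain, a pushout exists in C, and assume C satisfies the amalgamation property: for all one-to-one morphisms f : A → B and g : A → C there exist an object D and one-to-one morphisms f' : B → D and g' : C → D with f ≫ f' = g ≫ g'. Let n be a positive integer, let S be an object, and for i = 1, …, n let a_i : S → A_i and f_i : A_i → B_i be one-to-one morphisms; assume moreover that the wide pushouts of the family (a_i)_{i=1,…,n} and of the family (a_i ≫ f_i)_{i=1,…,n} exist in C. Then the canonical morphism from the wide pushout of (a_i) to the wide pushout of (a_i ≫ f_i) induced by the morphisms f_i is one-to-one. -/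
open CategoryTheory CategoryTheory.Limits

universe u v w

theorem amalg_family_aux {C : Type u} [Category.{v} C] (U : C ⥤ Type w)
    (hAP : ∀ ⦃A B E : C⦄ (f : A ⟶ B) (g : A ⟶ E),
      Function.Injective (U.map f) → Function.Injective (U.map g) →
      ∃ (D : C) (f' : B ⟶ D) (g' : E ⟶ D),
        Function.Injective (U.map f') ∧ Function.Injective (U.map g') ∧
          f ≫ f' = g ≫ g')
    (P : C) (n : ℕ) : ∀ (X Y : Fin n → C) (h : ∀ i, X i ⟶ P) (f : ∀ i, X i ⟶ Y i),
    (∀ i, Function.Injective (U.map (h i))) → (∀ i, Function.Injective (U.map (f i))) →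
    ∃ (D : C) (k : P ⟶ D), Function.Injective (U.map k) ∧
      ∀ i, ∃ g : Y i ⟶ D, Function.Injective (U.map g) ∧ f i ≫ g = h i ≫ k := by
  have hcomp : ∀ {A B E : C} (p : A ⟶ B) (q : B ⟶ E), Function.Injective (U.map p) →
      Function.Injective (U.map q) → Function.Injective (U.map (p ≫ q)) := by
    intro A B E p q hp hq x y hxy
    simp only [FunctorToTypes.map_comp_apply] at hxy
    exact hp (hq hxy)
  induction n with
  | zero =>
    intro X Y h f _ _
    refine ⟨P, 𝟙 P, fun x y hxy => by simpa using hxy, fun i => i.elim0⟩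
  | succ n ih =>
    intro X Y h f hh hf
    obtain ⟨D, k, hk, H⟩ := ih (fun i => X i.castSucc) (fun i => Y i.castSucc)
      (fun i => h i.castSucc) (fun i => f i.castSucc) (fun i => hh _) (fun i => hf _)
    obtain ⟨D', p, q, hp, hq, e⟩ := hAP (f (Fin.last n)) (h (Fin.last n) ≫ k) (hf _)
      (hcomp _ _ (hh _) hk)
    refine ⟨D', k ≫ q, hcomp _ _ hk hq, fun i => ?_⟩
    induction i using Fin.lastCases with
    | last => exact ⟨p, hp, by simpa using e⟩
    | cast i =>
      obtain ⟨g, hg, e'⟩ := H i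
      exact ⟨g ≫ q, hcomp _ _ hg hq, by rw [← Category.assoc, e', Category.assoc]⟩

/-- In a category with a functor `U : C ⥤ Type*` admitting pushouts of pairs of one-to-one
morphisms and satisfying the amalgamation property, the canonical morphism between wide
pushouts induced by a finite family of one-to-one morphisms `f i : A i ⟶ B i` under
one-to-one morphisms `a i : S ⟶ A i` is one-to-one. -/
theorem widePushout_map_injective_of_amalgamation
    {C : Type u} [Category.{v} C] (U : C ⥤ Type w)
    (hpo : ∀ ⦃X A B : C⦄ (f : X ⟶ A) (g : X ⟶ B),
      Function.Injective (U.map f) → Function.Injective (U.map g) → HasPushout f g)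
    (hAP : ∀ ⦃A B E : C⦄ (f : A ⟶ B) (g : A ⟶ E),
      Function.Injective (U.map f) → Function.Injective (U.map g) →
      ∃ (D : C) (f' : B ⟶ D) (g' : E ⟶ D),
        Function.Injective (U.map f') ∧ Function.Injective (U.map g') ∧
          f ≫ f' = g ≫ g')
    (n : ℕ) (hn : 0 < n) (S : C) (A B : Fin n → C)
    (a : ∀ i, S ⟶ A i) (f : ∀ i, A i ⟶ B i)
    (ha : ∀ i, Function.Injective (U.map (a i)))
    (hf : ∀ i, Function.Injective (U.map (f i)))
    [HasWidePushout S A a] [HasWidePushout S B fun i => a i ≫ f i] :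
    Function.Injective (U.map
      ((WidePushout.desc (WidePushout.head fun i => a i ≫ f i)
        (fun i => f i ≫ WidePushout.ι (fun i => a i ≫ f i) i)
        (fun i => by rw [← Category.assoc]; exact WidePushout.arrow_ι (fun i => a i ≫ f i) i)) :
          widePushout S A a ⟶ widePushout S B fun i => a i ≫ f i)) := by
  have hleft : ∀ {A B E : C} (p : A ⟶ B) (q : B ⟶ E) (r : A ⟶ E), p ≫ q = r →
      Function.Injective (U.map r) → Function.Injective (U.map p) := by
    intro A B E p q r hr hi x y hxy
    subst hr
    apply hi
    simp only [FunctorToTypes.map_comp_apply, hxy]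
  obtain ⟨D₀, d, -, H₀⟩ := amalg_family_aux U hAP S n (fun _ => S) A (fun _ => 𝟙 S) a
    (fun _ x y hxy => by simpa using hxy) ha
  choose e he e' using H₀
  have hι : ∀ i, Function.Injective (U.map (WidePushout.ι a i)) := fun i =>
    hleft _ (WidePushout.desc d e (fun i => by simpa using e' i)) _
      (WidePushout.ι_desc _ _ _ _ _) (he i)
  obtain ⟨D, k, hk, H⟩ := amalg_family_aux U hAP _ n A B (WidePushout.ι a) f hι hf
  choose g _ hg using H
  refine hleft _ (WidePushout.desc (WidePushout.head a ≫ k) g (fun i => by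
    rw [Category.assoc, hg, ← Category.assoc, WidePushout.arrow_ι])) k ?_ hk
  apply WidePushout.hom_ext
  · intro i
    rw [← Category.assoc, WidePushout.ι_desc, Category.assoc, WidePushout.ι_desc, hg]
  · rw [← Category.assoc, WidePushout.head_desc, WidePushout.head_desc]
end

section
/- Let P be a prevariety of L-structures satisfying the amalgamation property, let A be a structure in P, let I be a finite index type, let (B_i)_{i∈I} be a P-independent family of substructures of A, and for each i ∈ I let J_i be a finite index type and (C_{ij})_{j∈J_i} a family of substructures of A with C_{ij} ⊆ B_i for all j, such that for each i the family (C_{ij})_{j∈J_i} is P-independent. Then the combined family (C_{ij}) indexed by the sigma type Σ i, J_i is P-independent. Moreover, if P is in addition a quasivariety (closed under ultraproducts), the same conclusion holds without the finiteness assumptions on I and on the J_i. -/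
open FirstOrder FirstOrder.Language

universe u v w

namespace Paper

variable {L : FirstOrder.Language.{v, w}}

theorem hom_iSup_mem {A X : Type*} [L.Structure A] [L.Structure X] {I : Type*}
    (S : I → L.Substructure A) (Y : L.Substructure ↥(⨆ i, S i))
    (h : ∀ i (x : A) (hx : x ∈ S i), (⟨x, le_iSup S i hx⟩ : ↥(⨆ i, S i)) ∈ Y)
    (x : ↥(⨆ i, S i)) : x ∈ Y := by
  have h1 : (⨆ i, S i) ≤ Y.map (⨆ i, S i).subtype.toHom := by
    refine iSup_le fun i y hy => ?_
    exact ⟨⟨y, le_iSup S i hy⟩, h i y hy, rfl⟩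
  obtain ⟨y, hy, hyx⟩ := h1 x.2
  have : y = x := Subtype.ext hyx
  exact this ▸ hy

theorem hom_iSup_ext {A X : Type*} [L.Structure A] [L.Structure X] {I : Type*}
    (S : I → L.Substructure A) (f g : ↥(⨆ i, S i) →[L] X)
    (h : ∀ i (x : A) (hx : x ∈ S i),
      f ⟨x, le_iSup S i hx⟩ = g ⟨x, le_iSup S i hx⟩) : f = g := by
  ext x
  exact hom_iSup_mem (X := X) S (f.eqLocus g) h x

theorem amalg_finset {P : Set (SStr.{u} L)} (hAP : HasAmalgamation P)
    {K : Type u} (E : SStr.{u} L) (hE : E ∈ P) (D : K → SStr.{u} L) (hD : ∀ k, D k ∈ P)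
    (e : ∀ k, E.carrier ↪[L] (D k).carrier) (s : Finset K) :
    ∃ F ∈ P, ∃ m : E.carrier ↪[L] F.carrier, ∀ k ∈ s,
      ∃ f : (D k).carrier →[L] F.carrier, ∀ x, f (e k x) = m x := by
  classical
  induction s using Finset.induction_on with
  | empty => exact ⟨E, hE, Embedding.refl L _, by simp⟩
  | insert a s ha ih =>
    obtain ⟨F, hF, m, hm⟩ := ih
    obtain ⟨G, hG, p, q, hpq⟩ := hAP E (D a) F hE (hD a) hF (e a) m
    refine ⟨G, hG, q.comp m, fun k hk => ?_⟩
    rcases Finset.mem_insert.1 hk with rfl | hk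
    · exact ⟨p.toHom, fun x => hpq x⟩
    · obtain ⟨f, hf⟩ := hm k hk
      exact ⟨q.toHom.comp f, fun x => congrArg q (hf x)⟩

theorem amalg_family {P : Set (SStr.{u} L)} (hAP : HasAmalgamation P)
    {K : Type u} (E : SStr.{u} L) (hE : E ∈ P) (D : K → SStr.{u} L) (hD : ∀ k, D k ∈ P)
    (e : ∀ k, E.carrier ↪[L] (D k).carrier) (hfin : Finite K ∨ ClosedUnderUltraproducts P) :
    ∃ F ∈ P, ∃ m : E.carrier ↪[L] F.carrier, ∀ k,
      ∃ f : (D k).carrier →[L] F.carrier, ∀ x, f (e k x) = m x := by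
  classical
  rcases finite_or_infinite K with hK | hK
  · cases nonempty_fintype K
    obtain ⟨F, hF, m, hm⟩ := amalg_finset hAP E hE D hD e Finset.univ
    exact ⟨F, hF, m, fun k => hm k (Finset.mem_univ k)⟩
  replace hfin : ClosedUnderUltraproducts P :=
    hfin.resolve_left (fun h => not_finite K)
  obtain ⟨k0, hk0⟩ : ∃ k0, ∀ k, Nonempty (D k).carrier → Nonempty (D k0).carrier := by
    by_cases h : ∃ k, Nonempty (D k).carrier
    · exact ⟨h.choose, fun _ _ => h.choose_spec⟩
    · exact ⟨Classical.arbitrary K, fun k hk => (h ⟨k, hk⟩).elim⟩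
  choose F hF m hm using fun s : Finset K => amalg_finset hAP E hE D hD e (insert k0 s)
  have hφ : ∀ (s : Finset K) (k : K), ∃ φ : (D k).carrier → (F s).carrier,
      k ∈ s → ∃ f : (D k).carrier →[L] (F s).carrier, (∀ x, f (e k x) = m s x) ∧ ⇑f = φ := by
    intro s k
    by_cases hk : k ∈ s
    · obtain ⟨f, hf⟩ := hm s k (Finset.mem_insert_of_mem hk)
      exact ⟨f, fun _ => ⟨f, hf, rfl⟩⟩
    · obtain ⟨f, hf⟩ := hm s k0 (Finset.mem_insert_self _ _)
      exact ⟨fun d => f (Classical.choice (hk0 k ⟨d⟩)), fun h => (hk h).elim⟩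
  choose φ hφ using hφ
  let uf : Ultrafilter (Finset K) := Ultrafilter.of Filter.atTop
  have huf : ∀ k, ∀ᶠ s in (uf : Filter (Finset K)), k ∈ s := by
    intro k
    apply Ultrafilter.of_le
    filter_upwards [Filter.eventually_ge_atTop ({k} : Finset K)] with s hs
    exact hs (Finset.mem_singleton_self k)
  have hrel : ∀ {n : ℕ} (r : L.Relations n) (x : Fin n → ∀ s, (F s).carrier),
      (Structure.RelMap r fun i => (Quotient.mk'' (x i) : (uf : Filter (Finset K)).Product
        fun s => (F s).carrier)) ↔
      ∀ᶠ s in (uf : Filter (Finset K)), Structure.RelMap r fun i => x i s := by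
    intro n r x
    exact (relMap_quotient_mk' (s := (uf : Filter (Finset K)).productSetoid
        fun s => (F s).carrier) r x)
  refine ⟨_, hfin (Finset K) uf F hF, ⟨⟨fun x => Quotient.mk'' fun s => m s x, ?_⟩, ?_, ?_⟩, ?_⟩
  · intro x y hxy
    have h1 : ∀ᶠ s in (uf : Filter (Finset K)), m s x = m s y := Quotient.exact hxy
    obtain ⟨s, hs⟩ := h1.exists
    exact (m s).injective hs
  · intro n f x
    refine Eq.trans ?_ (Ultraproduct.funMap_cast f (fun i s => m s (x i))).symm
    refine congrArg (Quotient.mk _) (funext fun s => ?_)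
    exact (m s).map_fun f x
  · intro n r x
    refine (hrel r (fun i s => m s (x i))).trans ?_
    have : ∀ s, (Structure.RelMap r fun i => m s (x i)) ↔ Structure.RelMap r x :=
      fun s => (m s).map_rel r x
    simp [this]
  · intro k
    refine ⟨⟨fun d => Quotient.mk'' fun s => φ s k d, ?_, ?_⟩, ?_⟩
    · intro n f x
      refine Eq.trans ?_ (Ultraproduct.funMap_cast f (fun i s => φ s k (x i))).symm
      refine Quotient.sound ?_
      change ∀ᶠ s in (uf : Filter (Finset K)), _ = _
      filter_upwards [huf k] with s hs
      obtain ⟨g, -, hg⟩ := hφ s k hs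
      rw [← hg]
      exact g.map_fun f x
    · intro n r x hx
      refine (hrel r (fun i s => φ s k (x i))).2 ?_
      filter_upwards [huf k] with s hs
      obtain ⟨g, -, hg⟩ := hφ s k hs
      rw [← hg]
      exact g.map_rel r x hx
    · intro x
      refine Quotient.sound ?_
      change ∀ᶠ s in (uf : Filter (Finset K)), _ = _
      filter_upwards [huf k] with s hs
      obtain ⟨g, hg1, hg⟩ := hφ s k hs
      rw [← hg]
      exact hg1 x

theorem indep_of_le {P : Set (SStr.{u} L)} (hP : IsPrevariety P) (hAP : HasAmalgamation P)
    (A : SStr.{u} L) (hA : A ∈ P) {I : Type*} (B C : I → L.Substructure A.carrier)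
    (hCB : ∀ i, C i ≤ B i) (hB : PIndependent P A B)
    (hfin : Finite I ∨ ClosedUnderUltraproducts P) (X : SStr.{u} L) (hX : X ∈ P)
    (g : ∀ i, C i →[L] X.carrier) :
    ∃ h : ↥(⨆ i, C i) →[L] X.carrier, ∀ i (x : A.carrier) (hx : x ∈ C i),
      h ⟨x, le_iSup C i hx⟩ = g i ⟨x, hx⟩ := by
  classical
  let M : ULift.{u} Bool → SStr.{u} L := fun b => cond b.down X A
  have hM : ∀ b, M b ∈ P := by rintro ⟨_ | _⟩ <;> assumption
  let E : SStr.{u} L := SStr.mk (∀ b, (M b).carrier)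
  have hE : E ∈ P := hP.2.2 _ M hM
  let T := Σ p : {p : L.Substructure A.carrier × L.Substructure A.carrier // p.2 ≤ p.1},
    (p.1.2 →[L] X.carrier)
  let el : ∀ t : T, t.1.1.2 → E.carrier := fun t x b =>
    match b with
    | ⟨true⟩ => t.2 x
    | ⟨false⟩ => (x : A.carrier)
  have emb : ∀ t : T, ∃ f : t.1.1.2 ↪[L] E.carrier, ∀ x, f x = el t x := by
    intro t
    refine ⟨⟨⟨el t, ?_⟩, ?_, ?_⟩, fun _ => rfl⟩
    · intro x y hxy
      exact Subtype.ext (congrFun hxy ⟨false⟩)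
    · intro n f x
      funext b
      rcases b with ⟨_ | _⟩
      · rfl
      · exact t.2.map_fun f x
    · intro n r x
      constructor
      · intro h
        exact h ⟨false⟩
      · rintro h ⟨_ | _⟩
        · exact h
        · exact t.2.map_rel r x h
  choose em hem using emb
  have am : ∀ t : T, ∃ D ∈ P, ∃ (f : t.1.1.1 →[L] D.carrier) (e : E.carrier ↪[L] D.carrier),
      ∀ (x : A.carrier) (hx : x ∈ t.1.1.2), f ⟨x, t.1.2 hx⟩ = e (el t ⟨x, hx⟩) := by
    intro t
    obtain ⟨D, hD, f, e, hfe⟩ := hAP ⟨t.1.1.2⟩ ⟨t.1.1.1⟩ E (hP.2.1 A hA _) (hP.2.1 A hA _) hE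
      (Substructure.inclusion t.1.2) (em t)
    refine ⟨D, hD, f.toHom, e, fun x hx => ?_⟩
    rw [← hem]
    exact hfe ⟨x, hx⟩
  choose D hD f e hfe using am
  let t : I → T := fun i => ⟨⟨(B i, C i), hCB i⟩, g i⟩
  have hK : Finite (Set.range t) ∨ ClosedUnderUltraproducts P :=
    hfin.imp (fun h => by have := h; exact Set.finite_range t) id
  obtain ⟨F, hF, m, hm⟩ := amalg_family hAP (K := Set.range t) E hE (fun k => D k.1)
    (fun k => hD k.1) (fun k => e k.1) hK
  choose q hq using hm
  obtain ⟨h, hh, -⟩ := hB F hF (fun i => (q ⟨t i, i, rfl⟩).comp (f (t i)))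
  have hle : (⨆ i, C i) ≤ ⨆ i, B i := iSup_mono hCB
  let r : ↥(⨆ i, C i) →[L] F.carrier := h.comp (Substructure.inclusion hle).toHom
  have hr : ∀ i (x : A.carrier) (hx : x ∈ C i), r ⟨x, le_iSup C i hx⟩ = m (el (t i) ⟨x, hx⟩) := by
    intro i x hx
    have h1 := DFunLike.congr_fun (hh i) ⟨x, hCB i hx⟩
    refine Eq.trans h1 ?_
    refine Eq.trans (congrArg (q ⟨t i, i, rfl⟩) (hfe (t i) x hx)) ?_
    exact hq ⟨t i, i, rfl⟩ _
  have hmem : ∀ x, r x ∈ m.toHom.range :=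
    hom_iSup_mem (X := F.carrier) C (m.toHom.range.comap r) fun i x hx =>
      ⟨el (t i) ⟨x, hx⟩, (hr i x hx).symm⟩
  let pr : E.carrier →[L] X.carrier :=
    { toFun := fun y => y ⟨true⟩
      map_fun' := fun _ _ => rfl
      map_rel' := fun _ _ h => h ⟨true⟩ }
  refine ⟨(pr.comp m.equivRange.symm.toHom).comp (r.codRestrict _ hmem), fun i x hx => ?_⟩
  have h2 : r.codRestrict _ hmem ⟨x, le_iSup C i hx⟩ = m.equivRange (el (t i) ⟨x, hx⟩) :=
    Subtype.ext (hr i x hx)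
  change pr (m.equivRange.symm (r.codRestrict _ hmem ⟨x, le_iSup C i hx⟩)) = _
  rw [h2, FirstOrder.Language.Equiv.symm_apply_apply]
  rfl

/-- Corollary: in a prevariety with the amalgamation property, `P`-independent families of
`P`-independent families are `P`-independent (finiteness assumptions can be dropped when `P`
is a quasivariety). -/
theorem independent_of_independent_families
    {L : FirstOrder.Language.{v, w}} (P : Set (SStr.{u} L)) (hP : IsPrevariety P)
    (hAP : HasAmalgamation P) (A : SStr.{u} L) (hA : A ∈ P)
    {I : Type*} (B : I → L.Substructure A.carrier)
    {J : I → Type*} (Cf : ∀ i, J i → L.Substructure A.carrier)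
    (hCB : ∀ i j, Cf i j ≤ B i)
    (hBind : PIndependent P A B)
    (hCind : ∀ i, PIndependent P A (Cf i))
    (hfin : (Finite I ∧ ∀ i, Finite (J i)) ∨ ClosedUnderUltraproducts P) :
    PIndependent P A fun p : Σ i, J i => Cf p.1 p.2 := by
  intro X hX g
  choose gi hgi _ using fun i => hCind i X hX (fun j => g ⟨i, j⟩)
  obtain ⟨h, hh⟩ := indep_of_le hP hAP A hA B (fun i => ⨆ j, Cf i j)
    (fun i => iSup_le (hCB i)) hBind (hfin.imp And.left id) X hX gi
  have hle : (⨆ p : Σ i, J i, Cf p.1 p.2) ≤ ⨆ i, ⨆ j, Cf i j :=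
    iSup_le fun p => le_iSup_of_le p.1 (le_iSup (Cf p.1) p.2)
  refine ⟨h.comp (Substructure.inclusion hle).toHom, ?_, ?_⟩
  · rintro ⟨i, j⟩
    ext x
    refine Eq.trans (hh i x (le_iSup (Cf i) j x.2)) ?_
    exact DFunLike.congr_fun (hgi i j) x
  · intro h' hh'
    refine hom_iSup_ext _ _ _ ?_
    rintro ⟨i, j⟩ x hx
    refine Eq.trans (DFunLike.congr_fun (hh' ⟨i, j⟩) ⟨x, hx⟩) ?_
    refine Eq.trans ?_ (hh i x (le_iSup (Cf i) j hx)).symm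
    exact (DFunLike.congr_fun (hgi i j) ⟨x, hx⟩).symm
end Paper
end

section
/- Let P be a prevariety of L-structures satisfying the amalgamation property, let A be a structure in P, and let (B_i)_{i∈I} be a P-independent family of substructures of A. Then for every nonempty subset J ⊆ I, the subfamily (B_i)_{i∈J} is P-independent. -/
open FirstOrder FirstOrder.Language

universe u v w

namespace Paper

variable {L : FirstOrder.Language.{v, w}}

theorem exists_prod {L : FirstOrder.Language.{v, w}} (P : Set (SStr.{u} L)) (hP : IsPrevariety P)
    (A C : SStr.{u} L) (hA : A ∈ P) (hC : C ∈ P) :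
    ∃ E ∈ P, ∃ (p : E.carrier →[L] A.carrier) (q : E.carrier →[L] C.carrier),
      ∀ (X : Type u) [L.Structure X] (a : X →[L] A.carrier) (c : X →[L] C.carrier),
        ∃ e : X →[L] E.carrier, (∀ x, p (e x) = a x) ∧ (∀ x, q (e x) = c x) := by
  let M : ULift.{u} Bool → SStr.{u} L := fun b => match b with
    | ⟨true⟩ => A
    | ⟨false⟩ => C
  refine ⟨SStr.mk (∀ i, (M i).carrier), hP.2.2 _ M ?_, ?_, ?_, ?_⟩
  · rintro ⟨_ | _⟩
    · exact hC
    · exact hA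
  · exact ⟨fun x => x ⟨true⟩, fun _ _ => rfl, fun _ _ h => h ⟨true⟩⟩
  · exact ⟨fun x => x ⟨false⟩, fun _ _ => rfl, fun _ _ h => h ⟨false⟩⟩
  · intro X _ a c
    refine ⟨⟨fun x i => match i with
      | ⟨true⟩ => a x
      | ⟨false⟩ => c x, ?_, ?_⟩, fun _ => rfl, fun _ => rfl⟩
    · intro n f x
      funext i
      rcases i with ⟨_ | _⟩
      · exact c.map_fun f x
      · exact a.map_fun f x
    · intro n r x h i
      rcases i with ⟨_ | _⟩
      · exact c.map_rel r x h
      · exact a.map_rel r x h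

theorem sub_induct {L : FirstOrder.Language.{v, w}} {A : Type u} [L.Structure A]
    {K : Type*} (B : K → L.Substructure A) (T : L.Substructure ↥(⨆ i, B i))
    (h : ∀ i (b : B i), Substructure.inclusion (le_iSup B i) b ∈ T) : ∀ x, x ∈ T := by
  have : (⨆ i, B i) ≤ T.map (⨆ i, B i).subtype.toHom := by
    refine iSup_le fun i b hb => ?_
    exact ⟨_, h i ⟨b, hb⟩, rfl⟩
  intro x
  obtain ⟨y, hy, hxy⟩ := this x.2
  have : y = x := Subtype.ext hxy
  exact this ▸ hy

/-- Corollary: in a prevariety with the amalgamation property, every nonempty subfamily of a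
`P`-independent family of substructures is `P`-independent. -/
theorem subfamily_independent_of_amalgamation
    {L : FirstOrder.Language.{v, w}} (P : Set (SStr.{u} L)) (hP : IsPrevariety P)
    (hAP : HasAmalgamation P) (A : SStr.{u} L) (hA : A ∈ P)
    {I : Type*} (B : I → L.Substructure A.carrier) (hBind : PIndependent P A B)
    (J : Set I) (hJ : J.Nonempty) :
    PIndependent P A fun j : J => B j.1 := by
  classical
  intro C hC g
  refine existsUnique_of_exists_of_unique ?_ ?_
  · obtain ⟨E, hE, p, q, hpq⟩ := exists_prod P hP A C hA hC
    choose φ hp hq using fun j : J => hpq (B j.1) (B j.1).subtype.toHom (g j)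
    obtain ⟨j0, hj0⟩ := hJ
    let f : B j0 ↪[L] E.carrier :=
      { toFun := φ ⟨j0, hj0⟩
        inj' := fun x y hxy => by
          have := congrArg p hxy
          rw [hp, hp] at this
          exact Subtype.ext this
        map_fun' := (φ ⟨j0, hj0⟩).map_fun'
        map_rel' := fun r x => by
          refine ⟨fun h => ?_, (φ ⟨j0, hj0⟩).map_rel r x⟩
          have h2 := p.map_rel r _ h
          have : (p ∘ φ ⟨j0, hj0⟩ ∘ x) = (B j0).subtype ∘ x := by
            funext i
            exact hp ⟨j0, hj0⟩ (x i)
          have h3 : Structure.RelMap r ((B j0).subtype ∘ x) := this ▸ h2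
          exact ((B j0).subtype.map_rel r x).1 h3 }
    obtain ⟨D, hD, f', g', -⟩ := hAP ⟨B j0⟩ E A (hP.2.1 A hA _) hE hA f (B j0).subtype
    obtain ⟨h, hh, -⟩ := hBind D hD fun i =>
      if hi : i ∈ J then f'.toHom.comp (φ ⟨i, hi⟩) else g'.toHom.comp (B i).subtype.toHom
    have hle : (⨆ j : J, B j.1) ≤ ⨆ i, B i := iSup_le fun j => le_iSup B j.1
    let h' := h.comp (Substructure.inclusion hle).toHom
    have key : ∀ (j : J) (b : B j.1),
        h' (Substructure.inclusion (le_iSup (fun j : J => B j.1) j) b) = f' (φ j b) := by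
      intro j b
      have := DFunLike.congr_fun (hh j.1) b
      rw [dif_pos j.2] at this
      exact this
    have hr : ∀ x, h' x ∈ f'.toHom.range :=
      sub_induct (fun j : J => B j.1) (f'.toHom.range.comap h') fun j b =>
        ⟨φ j b, (key j b).symm⟩
    choose e he using fun x => Hom.mem_range.1 (hr x)
    have he' : ∀ x, f' (e x) = h' x := he
    let eh : ↥(⨆ j : J, B j.1) →[L] E.carrier :=
      { toFun := e
        map_fun' := fun F x => by
          apply f'.injective
          rw [he', f'.map_fun, h'.map_fun]
          congr 1
          funext i
          exact (he' (x i)).symm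
        map_rel' := fun r x hx => by
          rw [← f'.map_rel]
          have : f' ∘ e ∘ x = h' ∘ x := by
            funext i
            exact he' (x i)
          rw [this]
          exact h'.map_rel r x hx }
    refine ⟨q.comp eh, fun j => ?_⟩
    ext b
    have : e (Substructure.inclusion (le_iSup (fun j : J => B j.1) j) b) = φ j b :=
      f'.injective ((he' _).trans (key j b))
    exact (congrArg q this).trans (hq j b)
  · intro h₁ h₂ e₁ e₂
    ext x
    exact sub_induct (fun j : J => B j.1) (h₁.eqLocus h₂) (fun j b =>
      DFunLike.congr_fun ((e₁ j).trans (e₂ j).symm) b) x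
end Paper
end

section
/- Let B, S₀, S₁ be groups and let φ : ∀ i : Fin 2, B →* S_i be a family of two group homomorphisms, each injective but not surjective. Let G = Monoid.PushoutI φ be their amalgamated free product (the pushout S₀ *_B S₁), with canonical homomorphism base : B →* G. Then there exists an element g of G such that no element of the left coset g · base(B) has finite order; that is, there is g ∈ G with ¬ IsOfFinOrder (g * base b) for every b ∈ B. -/
open Monoid in
theorem exists_reduced_list_aux
    {B : Type*} [Group B] {S : Fin 2 → Type*} [∀ i, Group (S i)]
    (φ : ∀ i : Fin 2, B →* S i) (a : S 0) (c : S 1)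
    (ha : a ∉ (φ 0).range) (hc : c ∉ (φ 1).range) (n : ℕ) :
    ∃ l : List (Σ i, S i), (∀ x ∈ l, x.2 ∉ (φ x.1).range) ∧
      l.IsChain (fun x y => x.1 ≠ y.1) ∧ (∀ x ∈ l.head?, x.1 = 0) ∧ l.length = 2 * n ∧
      (l.map fun x => (CoprodI.of x.2 : CoprodI S)).prod =
        (CoprodI.of a * CoprodI.of c) ^ n := by
  induction n with
  | zero => exact ⟨[], by simp⟩
  | succ n ih =>
    obtain ⟨l, h1, h2, h3, h4, h5⟩ := ih
    refine ⟨⟨0, a⟩ :: ⟨1, c⟩ :: l, ?_, ?_, ?_, ?_, ?_⟩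
    · intro x hx
      rcases List.mem_cons.1 hx with rfl | hx
      · exact ha
      rcases List.mem_cons.1 hx with rfl | hx
      · exact hc
      · exact h1 x hx
    · refine List.isChain_cons.2 ⟨by simp, List.isChain_cons.2 ⟨?_, h2⟩⟩
      intro y hy
      rw [h3 y hy]
      simp
    · simp
    · simp [h4]; ring
    · rw [List.map_cons, List.map_cons, List.prod_cons, List.prod_cons, h5, pow_succ', mul_assoc]

/-- If `B` is a proper common subgroup of groups `S 0` and `S 1` (via injective, non-surjective
homomorphisms `φ i`), then the amalgamated free product `S 0 *_B S 1` contains a left coset of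
(the image of) `B` having no element of finite order. -/
theorem exists_coset_without_finite_order
    {B : Type*} [Group B] {S : Fin 2 → Type*} [∀ i, Group (S i)]
    (φ : ∀ i : Fin 2, B →* S i)
    (hinj : ∀ i, Function.Injective (φ i))
    (hnsurj : ∀ i, ¬Function.Surjective (φ i)) :
    ∃ g : Monoid.PushoutI φ, ∀ b : B, ¬IsOfFinOrder (g * Monoid.PushoutI.base φ b) := by
  have hex : ∀ i, ∃ a : S i, a ∉ (φ i).range := by
    intro i
    by_contra! h
    exact hnsurj i h
  obtain ⟨a, ha⟩ := hex 0
  obtain ⟨c, hc⟩ := hex 1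
  refine ⟨Monoid.PushoutI.of 0 a * Monoid.PushoutI.of 1 c, fun b hb => ?_⟩
  obtain ⟨n, hn, hpow⟩ := isOfFinOrder_iff_pow_eq_one.1 hb
  have hc' : c * φ 1 b ∉ (φ 1).range := by
    rwa [Subgroup.mul_mem_cancel_right (φ 1).range (MonoidHom.mem_range.2 ⟨b, rfl⟩)]
  obtain ⟨l, h1, h2, -, h4, h5⟩ := exists_reduced_list_aux φ a (c * φ 1 b) ha hc' n
  let w : Monoid.CoprodI.Word S :=
    ⟨l, fun x hx h => h1 x hx (by rw [h]; exact one_mem _), h2⟩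
  have hw : Monoid.PushoutI.Reduced φ w := h1
  have hp : Monoid.PushoutI.ofCoprodI (φ := φ) w.prod = 1 := by
    have : w.prod = (Monoid.CoprodI.of a * Monoid.CoprodI.of (c * φ 1 b)) ^ n := h5
    rw [this, map_pow, map_mul, Monoid.PushoutI.ofCoprodI_of, Monoid.PushoutI.ofCoprodI_of,
      map_mul, Monoid.PushoutI.of_apply_eq_base, ← mul_assoc]
    exact hpow
  have he := hw.eq_empty_of_mem_range hinj (by rw [hp]; exact one_mem _)
  have hl : l = [] := congrArg Monoid.CoprodI.Word.toList he
  rw [hl] at h4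
  simp at h4
  omega
end

section
/- Let Ω be an infinite type, let x ∈ Ω, let S = Equiv.Perm Ω, let B = MulAction.stabilizer S x, and let ι : B →* S denote the inclusion homomorphism of the subgroup B. Let φ : ∀ i : Fin 2, (B : Type _) →* S be the constant family with both components equal to ι, and let G = Monoid.PushoutI φ (the amalgamated free product S *_B S), with canonical homomorphism base : B →* G. Then there is no injective group homomorphism f : G →* S satisfying f (base b) = (b : S) for all b ∈ B; that is, S contains no subgroup containing B that is isomorphic over B to the coproduct of two copies of S with amalgamation of B. -/
theorem centralizer_aux {Ω : Type*} [Infinite Ω] [DecidableEq Ω] (x y : Ω) (g : Equiv.Perm Ω)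
    (hg : ∀ c : Equiv.Perm Ω, c x = x → c y = y → g * c = c * g) :
    g = 1 ∨ g = Equiv.swap x y := by
  have key : ∀ z, z ≠ x → z ≠ y → g z = z := by
    intro z hx hy
    by_contra hne
    obtain ⟨v, hv⟩ := Infinite.exists_notMem_finset ({x, y, z, g z} : Finset Ω)
    simp only [Finset.mem_insert, Finset.mem_singleton, not_or] at hv
    obtain ⟨h1, h2, h3, h4⟩ := hv
    have h := hg (Equiv.swap z v) (Equiv.swap_apply_of_ne_of_ne hx.symm (Ne.symm h1))
      (Equiv.swap_apply_of_ne_of_ne hy.symm (Ne.symm h2))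
    have h' := congrArg (fun p : Equiv.Perm Ω => p z) h
    simp only [Equiv.Perm.mul_apply, Equiv.swap_apply_left] at h'
    rw [Equiv.swap_apply_of_ne_of_ne hne (Ne.symm h4)] at h'
    exact h3 (g.injective h')
  have hgx : g x = x ∨ g x = y := by
    by_contra! h
    exact h.1 (g.injective (key _ h.1 h.2))
  have hgy : g y = x ∨ g y = y := by
    by_contra! h
    exact h.2 (g.injective (key _ h.1 h.2))
  have inj : g x = g y → x = y := fun h => g.injective h
  by_cases hx : g x = x
  · left
    ext z
    simp only [Equiv.Perm.one_apply]
    by_cases hzx : z = x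
    · rw [hzx, hx]
    · by_cases hzy : z = y
      · subst hzy
        rcases hgy with h | h
        · exact absurd (inj (hx.trans h.symm)).symm hzx
        · exact h
      · exact key z hzx hzy
  · right
    ext z
    rw [Equiv.swap_apply_def]
    grind

/-- For `Ω` infinite and `B` the stabilizer of a point in `S = Equiv.Perm Ω`, the symmetric
group `S` has no subgroup containing `B` that is isomorphic over `B` to the coproduct
`S *_B S` of two copies of `S` with amalgamation of `B`. -/
theorem no_amalgamated_coproduct_over_point_stabilizer
    {Ω : Type*} [Infinite Ω] (x : Ω) :
    ¬∃ f : Monoid.PushoutI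
        (fun _ : Fin 2 => (MulAction.stabilizer (Equiv.Perm Ω) x).subtype) →*
          Equiv.Perm Ω,
      Function.Injective f ∧
      ∀ b : (MulAction.stabilizer (Equiv.Perm Ω) x),
        f (Monoid.PushoutI.base
            (fun _ : Fin 2 => (MulAction.stabilizer (Equiv.Perm Ω) x).subtype) b) =
          (b : Equiv.Perm Ω) := by
  classical
  set φ : ∀ _ : Fin 2, (MulAction.stabilizer (Equiv.Perm Ω) x) →* Equiv.Perm Ω :=
    fun _ : Fin 2 => (MulAction.stabilizer (Equiv.Perm Ω) x).subtype with hφd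
  rintro ⟨f, hf, hb⟩
  have hφ : ∀ i, Function.Injective (φ i) := fun i => Subtype.val_injective
  obtain ⟨y, hy⟩ := exists_ne x
  have hne : Equiv.swap x y ≠ 1 := by
    intro h
    have h' := congrArg (fun p : Equiv.Perm Ω => p x) h
    simp at h'
    exact hy h'
  have main : ∀ i : Fin 2,
      f (Monoid.PushoutI.of (φ := φ) i (Equiv.swap x y)) = Equiv.swap x y := by
    intro i
    refine (centralizer_aux x y _ ?_).resolve_left ?_
    · intro c hcx hcy
      have hc : f (Monoid.PushoutI.of (φ := φ) i c) = c := by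
        have h := hb ⟨c, hcx⟩
        rw [← Monoid.PushoutI.of_apply_eq_base φ i] at h
        exact h
      have hcomm : Equiv.swap x y * c = c * Equiv.swap x y := by
        rw [Equiv.mul_swap_eq_swap_mul, hcx, hcy]
      have h := congrArg (fun s => f (Monoid.PushoutI.of (φ := φ) i s)) hcomm
      simpa only [map_mul, hc] using h
    · intro h
      rw [← map_one f] at h
      have h2 := hf h
      rw [← map_one (Monoid.PushoutI.of (φ := φ) i)] at h2
      exact hne (Monoid.PushoutI.of_injective hφ i h2)
  have heq := hf ((main 0).trans (main 1).symm)
  have hmem : Monoid.PushoutI.of (φ := φ) 0 (Equiv.swap x y) ∈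
      (Monoid.PushoutI.base φ).range := by
    rw [← Monoid.PushoutI.inf_of_range_eq_base_range hφ (i := 0) (j := 1) (by decide)]
    exact ⟨⟨_, rfl⟩, ⟨_, heq.symm⟩⟩
  obtain ⟨b, hbb⟩ := hmem
  rw [← Monoid.PushoutI.of_apply_eq_base φ 0] at hbb
  have h := Monoid.PushoutI.of_injective hφ 0 hbb
  have hbx : (b : Equiv.Perm Ω) x = x := b.2
  have h' : (b : Equiv.Perm Ω) = Equiv.swap x y := h
  rw [h', Equiv.swap_apply_left] at hbx
  exact hy hbx
end

section
/- Let M₀ be the monoid presented by two generators a, b subject to the single relation b * a = 1 (the bicyclic monoid, e.g., as a PresentedMonoid), and let M₁ be the monoid presented by two generators c, d subject to the single relation c * d = 1. Let φ₀ : FreeMonoid Unit →* M₀ send the generator to a and φ₁ : FreeMonoid Unit →* M₁ send the generator to c. Then: (1) φ₀ and φ₁ are injective; (2) the canonical homomorphism of 0 : M₀ →* Monoid.PushoutI φ into the pushout (the coproduct of M₀ and M₁ in monoids with amalgamation of the free monoid on one generator) is not injective — specifically, a * b ≠ 1 in M₀ but (of 0) (a * b) = 1 in the pushout. Consequently, the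 category of monoids does not have the amalgamation property. -/
namespace Paper19

/-- For `i = 0`: the single relation `b * a = 1` on the free monoid on generators
`a` (index `0`) and `b` (index `1`); for `i = 1`: the single relation `c * d = 1` on the
free monoid on generators `c` (index `0`) and `d` (index `1`). -/
def amalgRel : Fin 2 → FreeMonoid (Fin 2) → FreeMonoid (Fin 2) → Prop
  | 0 => fun x y => x = FreeMonoid.of 1 * FreeMonoid.of 0 ∧ y = 1
  | 1 => fun x y => x = FreeMonoid.of 0 * FreeMonoid.of 1 ∧ y = 1

/-- `M₀` is the monoid presented by `a, b` with `b * a = 1`, and `M₁` is the monoid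
presented by `c, d` with `c * d = 1`. -/
abbrev M (i : Fin 2) := PresentedMonoid (amalgRel i)

/-- The homomorphism from the free monoid on one generator sending the generator to `a`
(for `i = 0`), respectively to `c` (for `i = 1`). -/
def φ (i : Fin 2) : FreeMonoid Unit →* M i :=
  FreeMonoid.lift fun _ => PresentedMonoid.of (amalgRel i) 0

lemma rel0 : PresentedMonoid.of (amalgRel 0) 1 * PresentedMonoid.of (amalgRel 0) 0 = 1 :=
  PresentedMonoid.mk_eq_mk_of_rel (rels := amalgRel 0) ⟨rfl, rfl⟩

lemma rel1 : PresentedMonoid.of (amalgRel 1) 0 * PresentedMonoid.of (amalgRel 1) 1 = 1 :=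
  PresentedMonoid.mk_eq_mk_of_rel (rels := amalgRel 1) ⟨rfl, rfl⟩

lemma key {P : Type*} [Monoid P] (f : M 0 →* P) (g : M 1 →* P)
    (h : f (PresentedMonoid.of (amalgRel 0) 0) = g (PresentedMonoid.of (amalgRel 1) 0)) :
    f (PresentedMonoid.of (amalgRel 0) 0 * PresentedMonoid.of (amalgRel 0) 1) = 1 := by
  have h0 := congrArg f rel0
  have h1 := congrArg g rel1
  rw [map_mul, map_one] at h0 h1
  rw [← h] at h1
  rw [map_mul, left_inv_eq_right_inv h0 h1, h1]

lemma φ_of (i : Fin 2) : φ i (FreeMonoid.of ()) = PresentedMonoid.of (amalgRel i) 0 :=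
  FreeMonoid.lift_eval_of _ _

/-- The degree map. -/
def deg (i : Fin 2) : M i →* Multiplicative ℤ :=
  PresentedMonoid.lift ![Multiplicative.ofAdd 1, Multiplicative.ofAdd (-1)] (by
    fin_cases i <;> rintro _ _ ⟨rfl, rfl⟩ <;> simp)

lemma deg_φ (i : Fin 2) (x : FreeMonoid Unit) :
    deg i (φ i x) = Multiplicative.ofAdd (x.length : ℤ) := by
  induction x using FreeMonoid.recOn with
  | one => simp
  | of_mul u xs ih =>
    rw [map_mul, map_mul, ih, φ_of]
    simp [deg, ofAdd_add]

lemma φ_inj (i : Fin 2) : Function.Injective (φ i) := by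
  intro x y h
  have h2 := congrArg (deg i) h
  rw [deg_φ, deg_φ] at h2
  have h3 : x.length = y.length := by exact_mod_cast Multiplicative.ofAdd.injective h2
  apply FreeMonoid.toList.injective
  exact List.ext_getElem h3 (fun _ _ _ => rfl)

/-- The action of the bicyclic monoid on the natural numbers. -/
def act : M 0 →* Function.End ℕ :=
  PresentedMonoid.lift (rels := amalgRel 0) (M := Function.End ℕ) ![(Nat.succ : Function.End ℕ), (Nat.pred : Function.End ℕ)] (by
    rintro _ _ ⟨rfl, rfl⟩
    rw [map_mul, FreeMonoid.lift_eval_of, FreeMonoid.lift_eval_of, map_one]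
    rfl)

lemma ab_ne : PresentedMonoid.of (amalgRel 0) 0 * PresentedMonoid.of (amalgRel 0) 1 ≠ 1 := by
  intro h
  have h2 := congrArg act h
  rw [map_mul, map_one] at h2
  have h3 : (1 : ℕ) = 0 := congrFun h2 0
  omega

/-- Universe-lifted version of `φ`. -/
def uφ.{u} (i : Fin 2) : ULift.{u} (FreeMonoid Unit) →* ULift.{u} (M i) :=
  (MulEquiv.ulift.symm.toMonoidHom.comp (φ i)).comp MulEquiv.ulift.toMonoidHom

lemma uφ_inj.{u} (i : Fin 2) : Function.Injective (uφ.{u} i) :=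
  fun _ _ h => ULift.down_injective (φ_inj i (ULift.up_injective h))

open CategoryTheory in
/-- The maps `φ 0`, `φ 1` are injective, yet the coprojection `M₀ → M₀ ∐_{⟨u⟩} M₁` into the
coproduct of monoids with amalgamation of the free monoid on one generator is not injective:
`a * b ≠ 1` in `M₀`, but the image of `a * b` in the pushout is `1`.  Consequently the
category of monoids does not have the amalgamation property. -/
theorem monoid_amalgamation_failure :
    Function.Injective (φ 0) ∧ Function.Injective (φ 1) ∧
    (PresentedMonoid.of (amalgRel 0) 0 * PresentedMonoid.of (amalgRel 0) 1 ≠ 1) ∧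
    (Monoid.PushoutI.of (φ := φ) 0
      (PresentedMonoid.of (amalgRel 0) 0 * PresentedMonoid.of (amalgRel 0) 1) = 1) ∧
    ¬(∀ (A B C : MonCat) (f : A ⟶ B) (g : A ⟶ C),
        Function.Injective f → Function.Injective g →
          ∃ (D : MonCat) (f' : B ⟶ D) (g' : C ⟶ D),
            Function.Injective f' ∧ Function.Injective g' ∧ f ≫ f' = g ≫ g') := by
  refine ⟨φ_inj 0, φ_inj 1, ab_ne, ?_, ?_⟩
  · refine key (Monoid.PushoutI.of (φ := φ) 0) (Monoid.PushoutI.of (φ := φ) 1) ?_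
    rw [← φ_of 0, ← φ_of 1, Monoid.PushoutI.of_apply_eq_base, Monoid.PushoutI.of_apply_eq_base]
  · intro H
    obtain ⟨D, f', g', hf, hg, e⟩ := H (MonCat.of (ULift (FreeMonoid Unit)))
      (MonCat.of (ULift (M 0))) (MonCat.of (ULift (M 1)))
      (MonCat.ofHom (uφ 0))
      (MonCat.ofHom (uφ 1))
      (uφ_inj 0)
      (uφ_inj 1)
    have h1 := key (f'.hom.comp MulEquiv.ulift.symm.toMonoidHom)
      (g'.hom.comp MulEquiv.ulift.symm.toMonoidHom) (by
        rw [← φ_of 0, ← φ_of 1]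
        exact ConcreteCategory.congr_hom e (ULift.up (FreeMonoid.of ())))
    rw [← map_one (f'.hom.comp MulEquiv.ulift.symm.toMonoidHom)] at h1
    exact ab_ne (ULift.up_injective (hf h1))

end Paper19
end
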